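/- There exist constants c₁, c₂ > 0 and a threshold W such that for every odd integer w ≥ W, the number κ*(2,w) of equivalence classes of centrally symmetric 2-dimensional convex lattice polytopes P with |P ∩ ℤ²| = w is finite and satisfies exp(c₁·w^{1/3}) ≤ κ*(2,w) ≤ exp(c₂·w^{1/3}). -/

import Mathlib

open MeasureTheory

noncomputable section

/-- The canonical embedding of integer vectors into real vectors. -/
def intVec {d : ℕ} (x : Fin d → ℤ) : Fin d → ℝ := fun i => (x i : ℝ)

/-- `P` is a convex lattice polytope: the convex hull of a finite set of lattice points. -/
def IsConvexLatticePolytope (d : ℕ) (P : Set (Fin d → ℝ)) : Prop :=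
  ∃ V : Finset (Fin d → ℤ), P = convexHull ℝ (intVec '' (V : Set (Fin d → ℤ)))

/-- `P` is `d`-dimensional: its affine span is all of `ℝ^d`. -/
def IsFullDim (d : ℕ) (P : Set (Fin d → ℝ)) : Prop :=
  affineSpan ℝ P = ⊤

/-- The set of lattice points of `P`. -/
def latticePts (d : ℕ) (P : Set (Fin d → ℝ)) : Set (Fin d → ℤ) :=
  {x | intVec x ∈ P}

/-- The lattice `ℤ^d` viewed inside `ℝ^d`. -/
def latticeSet (d : ℕ) : Set (Fin d → ℝ) := Set.range (intVec (d := d))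

/-- Two subsets of `ℝ^d` are lattice-equivalent if some affine bijection of `ℝ^d`
preserving `ℤ^d` maps one onto the other. -/
def LatticeEquiv (d : ℕ) (P₁ P₂ : Set (Fin d → ℝ)) : Prop :=
  ∃ σ : (Fin d → ℝ) ≃ᵃ[ℝ] (Fin d → ℝ), σ '' latticeSet d = latticeSet d ∧ P₂ = σ '' P₁

/-- The type of equivalence classes of `d`-dimensional convex lattice polytopes
satisfying the predicate `Q`, modulo lattice equivalence. -/
def ClassesType (d : ℕ) (Q : Set (Fin d → ℝ) → Prop) : Type :=
  Quot (fun P₁ P₂ : {P : Set (Fin d → ℝ) // IsConvexLatticePolytope d P ∧ IsFullDim d P ∧ Q P} =>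
    LatticeEquiv d P₁.1 P₂.1)

/-- `P` is centrally symmetric (with some center `c`, i.e. `P = 2c - P`). -/
def IsCentrallySymmetric (d : ℕ) (P : Set (Fin d → ℝ)) : Prop :=
  ∃ c : Fin d → ℝ, ∀ x, x ∈ P ↔ (2 : ℝ) • c - x ∈ P

lemma chain_aux (n : ℕ) : ∀ (K : Finset (ℤ × ℤ)), K.card = n → ∀ p ∈ K,
    (∀ k ∈ K, p.1 < k.1 ∨ (k.1 = p.1 ∧ k.2 ≤ p.2)) →
    ∃ E : Multiset (ℤ × ℤ), (∀ e ∈ E, 1 ≤ e.1) ∧ p + E.sum ∈ K ∧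
      ∀ s : ℝ, (∀ k ∈ K, (k.2 : ℝ) - s * k.1 ≤
          p.2 - s * p.1 + (E.map (fun e => max ((e.2 : ℝ) - s * e.1) 0)).sum) ∧
        ∃ k ∈ K, (k.2 : ℝ) - s * k.1 =
          p.2 - s * p.1 + (E.map (fun e => max ((e.2 : ℝ) - s * e.1) 0)).sum := by
  induction n using Nat.strong_induction_on with
  | _ n ih =>
  intro K hK p hpK hp
  by_cases hne : (K.filter (fun k => p.1 < k.1)).Nonempty
  · obtain ⟨q, hq, hmax⟩ := Finset.exists_max_image (K.filter (fun k => p.1 < k.1))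
      (fun k => ((k.2 : ℝ) - p.2) / ((k.1 : ℝ) - p.1)) hne
    rw [Finset.mem_filter] at hq
    obtain ⟨hqK, hpq⟩ := hq
    have hpq' : (p.1 : ℝ) < q.1 := by exact_mod_cast hpq
    have hpos : (0 : ℝ) < (q.1 : ℝ) - p.1 := by linarith
    set σ : ℝ := ((q.2 : ℝ) - p.2) / ((q.1 : ℝ) - p.1) with hσ
    have hσq : (q.2 : ℝ) - p.2 = σ * ((q.1 : ℝ) - p.1) := by
      rw [hσ]; field_simp
    have hline : ∀ k ∈ K, (k.2 : ℝ) - p.2 ≤ σ * ((k.1 : ℝ) - p.1) := by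
      intro k hk
      rcases hp k hk with h | ⟨h1, h2⟩
      · have h' : (p.1 : ℝ) < k.1 := by exact_mod_cast h
        have := hmax k (by simp [hk, h])
        rwa [div_le_iff₀ (by linarith)] at this
      · have : (k.2 : ℝ) ≤ p.2 := by exact_mod_cast h2
        rw [h1]; simp; linarith
    have hge : ∀ k ∈ K, (p.1 : ℝ) ≤ k.1 := by
      intro k hk
      rcases hp k hk with h | ⟨h1, h2⟩
      · exact_mod_cast h.le
      · rw [h1]
    obtain ⟨E, hE1, hE2, hE3⟩ := ih (K.filter (fun k => q.1 ≤ k.1)).card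
      (by rw [← hK]; apply Finset.card_lt_card
          refine (Finset.filter_ssubset).2 ⟨p, hpK, by simpa using hpq⟩) _ rfl q (by simp [hqK]) (by
        intro k hk
        rw [Finset.mem_filter] at hk
        rcases hk.2.lt_or_eq with h | h
        · exact Or.inl h
        · right
          refine ⟨h.symm, ?_⟩
          have := hline k hk.1
          rw [← h, ← hσq] at this
          have : (k.2 : ℝ) ≤ q.2 := by linarith
          exact_mod_cast this)
    have hnn : ∀ s : ℝ, 0 ≤ (E.map (fun e => max ((e.2 : ℝ) - s * e.1) 0)).sum := by
      intro s; apply Multiset.sum_nonneg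
      intro x hx
      obtain ⟨e, -, rfl⟩ := Multiset.mem_map.1 hx
      exact le_max_right _ _
    refine ⟨(q - p) ::ₘ E, ?_, ?_, ?_⟩
    · intro e he
      rcases Multiset.mem_cons.1 he with rfl | he
      · simp; omega
      · exact hE1 e he
    · rw [Multiset.sum_cons]
      have : p + (q - p + E.sum) = q + E.sum := by abel
      rw [this]; exact (Finset.mem_filter.1 hE2).1
    · intro s
      obtain ⟨hs1, k0, hk0, hk0e⟩ := hE3 s
      rw [Multiset.map_cons, Multiset.sum_cons]
      have hcast : (((q - p).2 : ℤ) : ℝ) - s * (((q - p).1 : ℤ) : ℝ)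
          = (σ - s) * ((q.1 : ℝ) - p.1) := by
        simp only [Prod.snd_sub, Prod.fst_sub]; push_cast; rw [hσq]; ring
      rw [hcast]
      rcases le_or_gt σ s with hle | hlt
      · have hz : (E.map (fun e => max ((e.2 : ℝ) - s * e.1) 0)).sum = 0 := by
          obtain ⟨-, k1, hk1, hk1e⟩ := hE3 σ
          have h1 : (E.map (fun e => max ((e.2 : ℝ) - σ * e.1) 0)).sum ≤ 0 := by
            have := hline k1 (Finset.mem_filter.1 hk1).1
            linarith
          have h2 : (E.map (fun e => max ((e.2 : ℝ) - s * e.1) 0)).sum ≤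
              (E.map (fun e => max ((e.2 : ℝ) - σ * e.1) 0)).sum := by
            apply Multiset.sum_map_le_sum_map
            intro e he
            apply max_le_max _ le_rfl
            have : (1 : ℝ) ≤ e.1 := by exact_mod_cast hE1 e he
            nlinarith
          linarith [hnn s]
        have hm : max ((σ - s) * ((q.1 : ℝ) - p.1)) 0 = 0 := by
          apply max_eq_right; nlinarith
        rw [hz, hm]
        refine ⟨fun k hk => ?_, p, hpK, by ring⟩
        have h1 := hline k hk
        have h2 := hge k hk
        nlinarith
      · have hm : max ((σ - s) * ((q.1 : ℝ) - p.1)) 0 = (σ - s) * ((q.1 : ℝ) - p.1) := by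
          apply max_eq_left; nlinarith
        rw [hm]
        refine ⟨fun k hk => ?_, k0, (Finset.mem_filter.1 hk0).1, by rw [hk0e]; linarith⟩
        by_cases hkq : q.1 ≤ k.1
        · have := hs1 k (by simp [hk, hkq])
          linarith
        · have h1 := hline k hk
          have h2 : (k.1 : ℝ) < q.1 := by exact_mod_cast (not_le.1 hkq)
          have := hnn s
          nlinarith
  · have hall : ∀ k ∈ K, k.1 = p.1 ∧ k.2 ≤ p.2 := by
      intro k hk
      rcases hp k hk with h | h
      · exact absurd ⟨k, by simp [hk, h]⟩ hne
      · exact h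
    refine ⟨0, by simp, by simpa using hpK, fun s => ⟨fun k hk => ?_, p, hpK, by simp⟩⟩
    obtain ⟨h1, h2⟩ := hall k hk
    have : (k.2 : ℝ) ≤ p.2 := by exact_mod_cast h2
    rw [h1]; simp; linarith

/-- multisets of positive vectors with bounded sum -/
def BP (A B : ℕ) : Set (Multiset (ℤ × ℤ)) :=
  {M | (∀ e ∈ M, 1 ≤ e.1 ∧ 1 ≤ e.2) ∧ M.sum.1 ≤ A ∧ M.sum.2 ≤ B}

def zc : ℝ := ∑' k : ℕ, 1 / ((k : ℝ) + 1) ^ 3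

lemma geo_le (α : ℝ) (hα : 0 < α) (A : ℕ) :
    ∑ i : Fin A, Real.exp (-α * ((i : ℕ) + 1)) ≤ 1 / α := by
  rw [Fin.sum_univ_eq_sum_range (fun i => Real.exp (-α * ((i : ℕ) + 1))) A]
  have h1 : ∀ i : ℕ, Real.exp (-α * ((i : ℕ) + 1)) = Real.exp (-α) * Real.exp (-α) ^ i := by
    intro i
    rw [← Real.exp_nat_mul, ← Real.exp_add]; congr 1; ring
  simp_rw [h1, ← Finset.mul_sum]
  have hx0 := Real.exp_pos (-α)
  have hx1 : Real.exp (-α) < 1 := by rw [Real.exp_lt_one_iff]; linarith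
  have h2 : ∑ i ∈ Finset.range A, Real.exp (-α) ^ i ≤ (1 - Real.exp (-α))⁻¹ := by
    rw [← tsum_geometric_of_lt_one hx0.le hx1]
    exact (summable_geometric_of_lt_one hx0.le hx1).sum_le_tsum _ (fun i _ => by positivity)
  have h3 : Real.exp (-α) * (1 - Real.exp (-α))⁻¹ ≤ 1 / α := by
    rw [← div_eq_mul_inv, div_le_div_iff₀ (by linarith) hα]
    have h4 : α + 1 ≤ Real.exp α := Real.add_one_le_exp α
    have h5 : Real.exp (-α) * Real.exp α = 1 := by rw [← Real.exp_add]; simp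
    nlinarith
  exact (mul_le_mul_of_nonneg_left h2 hx0.le).trans h3

lemma logprod_le (α β : ℝ) (hα : 0 < α) (hβ : 0 < β) (A B : ℕ) :
    ∑ v : Fin A × Fin B, -Real.log (1 - Real.exp (-α * ((v.1 : ℕ) + 1) + -β * ((v.2 : ℕ) + 1)))
      ≤ zc * (1 / (α * β)) := by
  have hq : ∀ v : Fin A × Fin B,
      |Real.exp (-α * ((v.1 : ℕ) + 1) + -β * ((v.2 : ℕ) + 1))| < 1 := by
    intro v
    rw [abs_of_pos (Real.exp_pos _), Real.exp_lt_one_iff]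
    have : (0 : ℝ) ≤ ((v.1 : ℕ) : ℝ) := by positivity
    have : (0 : ℝ) ≤ ((v.2 : ℕ) : ℝ) := by positivity
    nlinarith
  have hs := hasSum_sum (s := Finset.univ)
    (fun v (_ : v ∈ Finset.univ) => Real.hasSum_pow_div_log_of_abs_lt_one (hq v))
  have hz : Summable (fun k : ℕ => 1 / ((k : ℝ) + 1) ^ 3) := by
    have := (summable_nat_add_iff 1).2 (Real.summable_one_div_nat_pow.2 (by norm_num : 1 < 3))
    simpa using this
  have hz2 : HasSum (fun k : ℕ => 1 / ((k : ℝ) + 1) ^ 3 * (1 / (α * β))) (zc * (1 / (α * β))) :=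
    hz.hasSum.mul_right _
  refine hasSum_le (fun k => ?_) hs hz2
  have hk : (0 : ℝ) < (k : ℝ) + 1 := by positivity
  have e1 : ∀ v : Fin A × Fin B,
      Real.exp (-α * ((v.1 : ℕ) + 1) + -β * ((v.2 : ℕ) + 1)) ^ (k + 1) / ((k : ℝ) + 1)
      = 1 / ((k : ℝ) + 1) * (Real.exp (-(α * (k + 1)) * ((v.1 : ℕ) + 1))
        * Real.exp (-(β * (k + 1)) * ((v.2 : ℕ) + 1))) := by
    intro v
    rw [← Real.exp_nat_mul, ← Real.exp_add, div_eq_mul_one_div, mul_comm]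
    congr 2
    push_cast; ring
  simp_rw [e1, ← Finset.mul_sum, Fintype.sum_prod_type, ← Finset.mul_sum, ← Finset.sum_mul]
  have g1 := geo_le (α * (k + 1)) (by positivity) A
  have g2 := geo_le (β * (k + 1)) (by positivity) B
  calc _ ≤ 1 / ((k : ℝ) + 1) * (1 / (α * (k + 1)) * (1 / (β * (k + 1)))) := by
        apply mul_le_mul_of_nonneg_left _ (by positivity)
        apply mul_le_mul g1 g2 (Finset.sum_nonneg fun i _ => (Real.exp_pos _).le) (by positivity)
    _ = _ := by field_simp

lemma sum_fst_eq (M : Multiset (ℤ × ℤ)) : M.sum.1 = (M.map (fun e => e.1)).sum := by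
  induction M using Multiset.induction with
  | empty => simp
  | cons a s ih => simp [ih]

lemma sum_snd_eq (M : Multiset (ℤ × ℤ)) : M.sum.2 = (M.map (fun e => e.2)).sum := by
  induction M using Multiset.induction with
  | empty => simp
  | cons a s ih => simp [ih]

def vv {A B : ℕ} (v : Fin A × Fin B) : ℤ × ℤ := (((v.1 : ℕ) : ℤ) + 1, ((v.2 : ℕ) : ℤ) + 1)

lemma vv_inj {A B : ℕ} : Function.Injective (vv (A := A) (B := B)) := by
  rintro ⟨⟨a, ha⟩, ⟨b, hb⟩⟩ ⟨⟨c, hc⟩, ⟨d, hd⟩⟩ h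
  simp [vv] at h ⊢
  omega

lemma BP_mem_le {A B : ℕ} {M : Multiset (ℤ × ℤ)} (hM : M ∈ BP A B) :
    ∀ e ∈ M, e.1 ≤ A ∧ e.2 ≤ B := by
  obtain ⟨h1, h2, h3⟩ := hM
  intro e he
  rw [sum_fst_eq] at h2
  rw [sum_snd_eq] at h3
  constructor
  · refine le_trans ?_ h2
    apply Multiset.single_le_sum _ _ (Multiset.mem_map_of_mem _ he)
    intro x hx
    obtain ⟨y, hy, rfl⟩ := Multiset.mem_map.1 hx
    have := h1 y hy; omega
  · refine le_trans ?_ h3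
    apply Multiset.single_le_sum _ _ (Multiset.mem_map_of_mem _ he)
    intro x hx
    obtain ⟨y, hy, rfl⟩ := Multiset.mem_map.1 hx
    have := h1 y hy; omega

lemma BP_mem_range {A B : ℕ} {M : Multiset (ℤ × ℤ)} (hM : M ∈ BP A B) :
    ∀ e ∈ M, ∃ v : Fin A × Fin B, vv v = e := by
  intro e he
  obtain ⟨h1, h2⟩ := BP_mem_le hM e he
  obtain ⟨h3, h4⟩ := hM.1 e he
  refine ⟨(⟨(e.1 - 1).toNat, by omega⟩, ⟨(e.2 - 1).toNat, by omega⟩), ?_⟩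
  ext <;> simp [vv] <;> omega

lemma BP_card {A B : ℕ} {M : Multiset (ℤ × ℤ)} (hM : M ∈ BP A B) : M.card ≤ A := by
  obtain ⟨h1, h2, h3⟩ := hM
  rw [sum_fst_eq] at h2
  have := Multiset.card_nsmul_le_sum (s := M.map (fun e => e.1)) (a := (1 : ℤ)) (by
    intro x hx
    obtain ⟨y, hy, rfl⟩ := Multiset.mem_map.1 hx
    exact (h1 y hy).1)
  simp at this
  omega

lemma BP_sum {A B : ℕ} {M : Multiset (ℤ × ℤ)} (hM : M ∈ BP A B) (f : ℤ × ℤ → ℝ) :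
    (M.map f).sum = ∑ v : Fin A × Fin B, (M.count (vv v) : ℝ) * f (vv v) := by
  rw [Finset.sum_multiset_map_count]
  simp only [nsmul_eq_mul]
  rw [← Finset.sum_image (s := Finset.univ) (g := vv) (f := fun x => (M.count x : ℝ) * f x)
    (fun a _ b _ h => vv_inj h)]
  apply Finset.sum_subset
  · intro e he
    obtain ⟨v, hv⟩ := BP_mem_range hM e (Multiset.mem_toFinset.1 he)
    exact Finset.mem_image.2 ⟨v, Finset.mem_univ _, hv⟩
  · intro x _ hx
    rw [Multiset.mem_toFinset] at hx
    simp [hx]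

lemma BP_bound (A B : ℕ) (hA : 1 ≤ A) (hB : 1 ≤ B) :
    (BP A B).Finite ∧ ((BP A B).ncard : ℝ) ≤ Real.exp ((2 + zc) * ((A : ℝ) * B) ^ ((1 : ℝ) / 3)) := by
  have hA' : (0 : ℝ) < A := by exact_mod_cast hA
  have hB' : (0 : ℝ) < B := by exact_mod_cast hB
  set L : ℝ := ((A : ℝ) * B) ^ ((1 : ℝ) / 3) with hL
  have hL0 : 0 < L := by positivity
  have hL3 : L ^ 3 = A * B := by
    rw [hL, ← Real.rpow_natCast, ← Real.rpow_mul (by positivity)]; norm_num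
  set α : ℝ := L / A with hα
  set β : ℝ := L / B with hβ
  have hα0 : 0 < α := by positivity
  have hβ0 : 0 < β := by positivity
  let F : Multiset (ℤ × ℤ) → (Fin A × Fin B → ℕ) := fun M v => M.count (vv v)
  let T : Finset (Fin A × Fin B → ℕ) := Fintype.piFinset (fun _ => Finset.range (A + 1))
  have hFT : ∀ M ∈ BP A B, F M ∈ T := by
    intro M hM
    simp only [T, Fintype.mem_piFinset, Finset.mem_range, F]
    intro v
    have := Multiset.count_le_card (vv v) M
    have := BP_card hM
    omega
  have hFinj : Set.InjOn F (BP A B) := by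
    intro M hM N hN h
    ext e
    by_cases he : ∃ v : Fin A × Fin B, vv v = e
    · obtain ⟨v, rfl⟩ := he
      exact congrFun h v
    · rw [Multiset.count_eq_zero_of_notMem (fun h => he (BP_mem_range hM e h)),
        Multiset.count_eq_zero_of_notMem (fun h => he (BP_mem_range hN e h))]
  have hfin : (BP A B).Finite := Set.Finite.of_finite_image
    ((T.finite_toSet).subset (by rintro _ ⟨M, hM, rfl⟩; exact hFT M hM)) hFinj
  refine ⟨hfin, ?_⟩
  set q : Fin A × Fin B → ℝ := fun v =>
    Real.exp (-α * ((v.1 : ℕ) + 1) + -β * ((v.2 : ℕ) + 1)) with hq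
  have hq1 : ∀ v, q v < 1 := by
    intro v
    rw [hq]; simp only
    rw [Real.exp_lt_one_iff]
    have : (0 : ℝ) ≤ ((v.1 : ℕ) : ℝ) := by positivity
    have : (0 : ℝ) ≤ ((v.2 : ℕ) : ℝ) := by positivity
    nlinarith
  have hq0 : ∀ v, 0 < q v := fun v => Real.exp_pos _
  have hw : ∀ M ∈ BP A B, Real.exp (-(2 * L)) ≤ ∏ v, q v ^ (F M v) := by
    intro M hM
    have : ∏ v, q v ^ (F M v) = Real.exp (∑ v : Fin A × Fin B, (F M v : ℝ) *
        (-α * ((v.1 : ℕ) + 1) + -β * ((v.2 : ℕ) + 1))) := by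
      rw [Real.exp_sum]
      refine Finset.prod_congr rfl fun v _ => ?_
      rw [hq, ← Real.exp_nat_mul]
    rw [this, Real.exp_le_exp]
    have h1 := BP_sum hM (fun e => -α * (e.1 : ℝ) + -β * (e.2 : ℝ))
    simp only [vv] at h1
    push_cast at h1
    have h2 : (M.map (fun e => -α * (e.1 : ℝ) + -β * (e.2 : ℝ))).sum
        = -α * (M.sum.1 : ℝ) + -β * (M.sum.2 : ℝ) := by
      clear h1 this hM
      induction M using Multiset.induction with
      | empty => simp
      | cons a s ih =>
        rw [Multiset.map_cons, Multiset.sum_cons, ih, Multiset.sum_cons, Prod.fst_add, Prod.snd_add]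
        push_cast; ring
    have h3 : (M.sum.1 : ℝ) ≤ A := by exact_mod_cast hM.2.1
    have h4 : (M.sum.2 : ℝ) ≤ B := by exact_mod_cast hM.2.2
    have h5 : α * A = L := by rw [hα]; field_simp
    have h6 : β * B = L := by rw [hβ]; field_simp
    have h7 : (∑ v : Fin A × Fin B, (F M v : ℝ) *
        (-α * ((v.1 : ℕ) + 1) + -β * ((v.2 : ℕ) + 1))) =
        -α * (M.sum.1 : ℝ) + -β * (M.sum.2 : ℝ) := by rw [← h2, h1]; rfl
    rw [h7]
    nlinarith
  have hprod : ∑ m ∈ T, ∏ v, q v ^ (m v) ≤ Real.exp (zc * L) := by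
    rw [← Finset.prod_univ_sum (fun _ => Finset.range (A + 1)) (fun v j => q v ^ j)]
    have h1 : ∏ v, ∑ j ∈ Finset.range (A + 1), q v ^ j ≤ ∏ v, Real.exp (-Real.log (1 - q v)) := by
      apply Finset.prod_le_prod
      · intro v _; exact Finset.sum_nonneg fun j _ => pow_nonneg (hq0 v).le _
      · intro v _
        rw [Real.exp_neg, Real.exp_log (by linarith [hq1 v])]
        rw [← tsum_geometric_of_lt_one (hq0 v).le (hq1 v)]
        exact (summable_geometric_of_lt_one (hq0 v).le (hq1 v)).sum_le_tsum _
          (fun i _ => pow_nonneg (hq0 v).le _)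
    refine h1.trans ?_
    rw [← Real.exp_sum, Real.exp_le_exp]
    refine (logprod_le α β hα0 hβ0 A B).trans (le_of_eq ?_)
    congr 1
    rw [hα, hβ]; field_simp; linarith
  have hcount : ((BP A B).ncard : ℝ) * Real.exp (-(2 * L)) ≤ Real.exp (zc * L) := by
    refine le_trans ?_ hprod
    rw [Set.ncard_eq_toFinset_card _ hfin, ← nsmul_eq_mul]
    calc _ ≤ ∑ M ∈ hfin.toFinset, ∏ v, q v ^ (F M v) :=
          Finset.card_nsmul_le_sum _ _ _ (fun M hM => hw M (hfin.mem_toFinset.1 hM))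
      _ = ∑ m ∈ hfin.toFinset.image F, ∏ v, q v ^ (m v) := by
          rw [Finset.sum_image]
          intro a ha b hb h
          exact hFinj (hfin.mem_toFinset.1 ha) (hfin.mem_toFinset.1 hb) h
      _ ≤ _ := by
          apply Finset.sum_le_sum_of_subset_of_nonneg
          · intro m hm
            obtain ⟨M, hM, rfl⟩ := Finset.mem_image.1 hm
            exact hFT M (hfin.mem_toFinset.1 hM)
          · intro m _ _
            exact Finset.prod_nonneg fun v _ => pow_nonneg (hq0 v).le _
  have : Real.exp ((2 + zc) * L) = Real.exp (zc * L) * Real.exp (2 * L) := by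
    rw [← Real.exp_add]; congr 1; ring
  rw [this]
  rw [Real.exp_neg, ← div_eq_mul_inv, div_le_iff₀ (Real.exp_pos _)] at hcount
  exact hcount

abbrev Code := (ℤ × ℤ × ℤ) × Multiset (ℤ × ℤ) × Multiset (ℤ × ℤ)

def HC (c : Code) (s : ℝ) : ℝ :=
  (c.1.2.1 : ℝ) - s * c.1.1 + c.1.2.2 * max (-s) 0
    + (c.2.1.map (fun e => max ((e.2 : ℝ) - s * e.1) 0)).sum
    + (c.2.2.map (fun e => max (-(e.2 : ℝ) - s * e.1) 0)).sum

def IsCode (P : Set (Fin 2 → ℝ)) (c : Code) : Prop :=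
  (∀ z ∈ P, (c.1.1 : ℝ) ≤ z 0) ∧ (∃ z ∈ P, z 0 = (c.1.1 : ℝ)) ∧
  ∀ s : ℝ, (∀ z ∈ P, z 1 - s * z 0 ≤ HC c s) ∧ ∃ z ∈ P, z 1 - s * z 0 = HC c s

lemma IsCode.subset {P P' : Set (Fin 2 → ℝ)} {c : Code} (h : IsCode P c) (h' : IsCode P' c)
    (hs : ∀ z ∈ P, -z ∈ P) (hs' : ∀ z ∈ P', -z ∈ P') (hc : Convex ℝ P') (hcl : IsClosed P') :
    P ⊆ P' := by
  intro z hz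
  by_contra hzn
  obtain ⟨f, u, hfz, hfu⟩ := geometric_hahn_banach_point_closed hc hcl hzn
  have hf : ∀ x : Fin 2 → ℝ, f x = x 0 * f (Pi.single 0 1) + x 1 * f (Pi.single 1 1) := by
    intro x
    have : x = x 0 • (Pi.single 0 1 : Fin 2 → ℝ) + x 1 • (Pi.single 1 1 : Fin 2 → ℝ) := by
      ext i; fin_cases i <;> simp
    conv_lhs => rw [this]
    simp
  set c0 := f (Pi.single 0 1)
  set c1 := f (Pi.single 1 1)
  rw [hf] at hfz
  have hfu' : ∀ x ∈ P', z 0 * c0 + z 1 * c1 < x 0 * c0 + x 1 * c1 := by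
    intro x hx
    have := hfu x hx
    rw [hf] at this; linarith
  obtain ⟨a1, a2, a3⟩ := h
  obtain ⟨b1, ⟨zl, hzl, hzle⟩, b3⟩ := h'
  rcases lt_trichotomy c1 0 with hc1 | hc1 | hc1
  · obtain ⟨x, hx, hxe⟩ := (b3 (-(c0 / c1))).2
    have e1 := (a3 (-(c0 / c1))).1 z hz
    have e2 := hfu' x hx
    rw [← hxe] at e1
    have e3 : c1 * (x 1 - -(c0 / c1) * x 0) ≤ c1 * (z 1 - -(c0 / c1) * z 0) :=
      mul_le_mul_of_nonpos_left e1 hc1.le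
    have e4 : ∀ t : Fin 2 → ℝ, c1 * (t 1 - -(c0 / c1) * t 0) = t 0 * c0 + t 1 * c1 := by
      have := hc1.ne; intro t; field_simp; ring
    rw [e4, e4] at e3
    linarith
  · rw [hc1] at hfu'
    rcases lt_trichotomy c0 0 with h0 | h0 | h0
    · have e1 := hfu' _ (hs' _ hzl)
      have e2 := a1 _ (hs _ hz)
      simp at e1 e2
      rw [hzle] at e1
      nlinarith
    · have := hfu' _ hzl
      simp [h0] at this
    · have e1 := hfu' _ hzl
      have e2 := a1 _ hz
      rw [hzle] at e1
      nlinarith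
  · obtain ⟨x, hx, hxe⟩ := (b3 (-(c0 / c1))).2
    have e1 := (a3 (-(c0 / c1))).1 (-z) (hs _ hz)
    have e2 := hfu' (-x) (hs' _ hx)
    rw [← hxe] at e1
    have e3 := mul_le_mul_of_nonneg_left e1 hc1.le
    have e4 : ∀ t : Fin 2 → ℝ, c1 * (t 1 - -(c0 / c1) * t 0) = t 0 * c0 + t 1 * c1 := by
      intro t; field_simp; ring
    rw [e4, e4] at e3
    simp at e2 e3
    linarith

lemma split_sum (E : Multiset (ℤ × ℤ)) (hE : ∀ e ∈ E, 1 ≤ e.1) :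
    ∃ (D : ℤ) (M1 M2 : Multiset (ℤ × ℤ)), 0 ≤ D ∧ (∀ e ∈ M1, 1 ≤ e.1 ∧ 1 ≤ e.2) ∧
      (∀ e ∈ M2, 1 ≤ e.1 ∧ 1 ≤ e.2) ∧ E.sum.1 = D + M1.sum.1 + M2.sum.1 ∧
      E.sum.2 = M1.sum.2 - M2.sum.2 ∧ 0 ≤ M1.sum.1 ∧ 0 ≤ M2.sum.1 ∧
      ((E.map (fun e => max ((e.2 : ℝ) - 0 * e.1) 0)).sum = M1.sum.2) ∧
      ∀ s : ℝ, (E.map (fun e => max ((e.2 : ℝ) - s * e.1) 0)).sum =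
        D * max (-s) 0 + (M1.map (fun e => max ((e.2 : ℝ) - s * e.1) 0)).sum
         + (M2.map (fun e => max (-(e.2 : ℝ) - s * e.1) 0)).sum := by
  induction E using Multiset.induction with
  | empty => exact ⟨0, 0, 0, by simp⟩
  | cons a E ih =>
    obtain ⟨D, M1, M2, h1, h2, h3, h4, h5, h6, h7, h9, h8⟩ :=
      ih (fun e he => hE e (Multiset.mem_cons_of_mem he))
    have ha := hE a (Multiset.mem_cons_self a E)
    have ha' : (1 : ℝ) ≤ a.1 := by exact_mod_cast ha
    rcases lt_trichotomy a.2 0 with hc | hc | hc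
    · refine ⟨D, M1, (a.1, -a.2) ::ₘ M2, h1, h2, ?_, ?_, ?_, h6, ?_, ?_, ?_⟩
      · intro e he
        rcases Multiset.mem_cons.1 he with rfl | he
        · simp; omega
        · exact h3 e he
      · simp [h4]; ring
      · simp [h5]; ring
      · simp; omega
      · have : (a.2 : ℝ) < 0 := by exact_mod_cast hc
        rw [Multiset.map_cons, Multiset.sum_cons, h9, max_eq_right (by linarith)]; simp
      · intro s
        simp only [Multiset.map_cons, Multiset.sum_cons, h8 s]
        push_cast; rw [neg_neg]; ring
    · refine ⟨D + a.1, M1, M2, by omega, h2, h3, ?_, ?_, h6, h7, ?_, ?_⟩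
      · simp [h4]; ring
      · simp [h5, hc]
      · rw [Multiset.map_cons, Multiset.sum_cons, h9, hc]; simp
      · intro s
        simp only [Multiset.map_cons, Multiset.sum_cons, h8 s, hc]
        have : max (((0 : ℤ) : ℝ) - s * a.1) 0 = a.1 * max (-s) 0 := by
          rw [mul_max_of_nonneg _ _ (by linarith)]; simp; congr 1; ring
        rw [this]
        push_cast; ring
    · refine ⟨D, a ::ₘ M1, M2, h1, ?_, h3, ?_, ?_, ?_, h7, ?_, ?_⟩
      · intro e he
        rcases Multiset.mem_cons.1 he with rfl | he
        · omega
        · exact h2 e he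
      · simp [h4]; ring
      · simp [h5]; ring
      · simp; omega
      · have : (0 : ℝ) < a.2 := by exact_mod_cast hc
        rw [Multiset.map_cons, Multiset.sum_cons, h9, max_eq_left (by linarith)]; simp
      · intro s
        simp only [Multiset.map_cons, Multiset.sum_cons, h8 s]
        ring

lemma hull_le {S : Set (Fin 2 → ℝ)} (c0 c1 t : ℝ) (h : ∀ x ∈ S, c0 * x 0 + c1 * x 1 ≤ t) :
    ∀ x ∈ convexHull ℝ S, c0 * x 0 + c1 * x 1 ≤ t := by
  have hc : Convex ℝ {x : Fin 2 → ℝ | c0 * x 0 + c1 * x 1 ≤ t} := by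
    intro x hx y hy a b ha hb hab
    simp only [Set.mem_ofPred_eq, Pi.add_apply, Pi.smul_apply, smul_eq_mul] at *
    have : t = a * t + b * t := by rw [← add_mul, hab, one_mul]
    rw [this]
    nlinarith [mul_le_mul_of_nonneg_left hx ha, mul_le_mul_of_nonneg_left hy hb]
  exact fun x hx => convexHull_min (fun y hy => h y hy) hc hx

lemma exists_code {P : Set (Fin 2 → ℝ)} (hP : IsConvexLatticePolytope 2 P) (hne : P.Nonempty)
    (a b : ℕ) (hab : ∀ z ∈ P, |z 0| ≤ a ∧ |z 1| ≤ b) :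
    ∃ c : Code, IsCode P c ∧ |c.1.1| ≤ a ∧ |c.1.2.1| ≤ b ∧ 0 ≤ c.1.2.2 ∧ c.1.2.2 ≤ 2 * a ∧
      c.2.1 ∈ BP (2 * a) (2 * b) ∧ c.2.2 ∈ BP (2 * a) (2 * b) := by
  obtain ⟨V, rfl⟩ := hP
  have hVne : V.Nonempty := by
    by_contra h
    rw [Finset.not_nonempty_iff_eq_empty] at h
    simp [h] at hne
  set K : Finset (ℤ × ℤ) := V.image (fun v => (v 0, v 1)) with hK
  have hVK : ∀ v ∈ V, (v 0, v 1) ∈ K := fun v hv => Finset.mem_image_of_mem _ hv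
  have hKV : ∀ k ∈ K, ∃ z ∈ convexHull ℝ (intVec '' (V : Set (Fin 2 → ℤ))),
      z 0 = (k.1 : ℝ) ∧ z 1 = (k.2 : ℝ) := by
    intro k hk
    obtain ⟨v, hv, rfl⟩ := Finset.mem_image.1 hk
    exact ⟨intVec v, subset_convexHull ℝ _ ⟨v, hv, rfl⟩, rfl, rfl⟩
  have hKb : ∀ k ∈ K, |k.1| ≤ a ∧ |k.2| ≤ b := by
    intro k hk
    obtain ⟨z, hz, h0, h1⟩ := hKV k hk
    have := hab z hz
    rw [h0, h1] at this
    exact_mod_cast this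
  obtain ⟨p0, hp0, hmin⟩ := Finset.exists_min_image K (fun k => k.1) (hVne.image _)
  obtain ⟨p, hp, hmax⟩ := Finset.exists_max_image (K.filter (fun k => k.1 = p0.1)) (fun k => k.2)
    ⟨p0, by simp [hp0]⟩
  rw [Finset.mem_filter] at hp
  obtain ⟨E, hE1, hE2, hE3⟩ := chain_aux _ K rfl p hp.1 (by
    intro k hk
    rcases (hmin k hk).lt_or_eq with h | h
    · left; rw [hp.2]; exact h
    · right; rw [hp.2]; exact ⟨h.symm, hmax k (by simp [hk, h])⟩)
  obtain ⟨D, M1, M2, h1, h2, h3, h4, h5, h6, h7, h9, h8⟩ := split_sum E hE1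
  have hpb := hKb p hp.1
  have heb := hKb _ hE2
  obtain ⟨-, k0, hk0, hk0e⟩ := hE3 0
  have hk0b := hKb k0 hk0
  rw [h9] at hk0e
  have hk0e' : k0.2 = p.2 + M1.sum.2 := by
    simp only [zero_mul, sub_zero] at hk0e; exact_mod_cast hk0e
  simp only [abs_le, Prod.fst_add, Prod.snd_add] at hpb heb hk0b
  refine ⟨((p.1, p.2, D), M1, M2), ⟨?_, ?_, ?_⟩, ?_, ?_, h1, ?_, ⟨h2, ?_, ?_⟩, ⟨h3, ?_, ?_⟩⟩
  · intro z hz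
    have := hull_le (-1) 0 (-(p.1 : ℝ)) (by
      rintro _ ⟨v, hv, rfl⟩
      have := hmin _ (hVK v hv)
      rw [← hp.2] at this
      have : (p.1 : ℝ) ≤ v 0 := by exact_mod_cast this
      simp [intVec]; linarith) z hz
    simp at this ⊢; linarith
  · obtain ⟨z, hz, h0, -⟩ := hKV p hp.1
    exact ⟨z, hz, h0⟩
  · intro s
    have hH : HC ((p.1, p.2, D), M1, M2) s =
        p.2 - s * p.1 + (E.map (fun e => max ((e.2 : ℝ) - s * e.1) 0)).sum := by
      rw [h8 s, HC]; ring
    rw [hH]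
    obtain ⟨g1, k, hk, hke⟩ := hE3 s
    constructor
    · intro z hz
      have := hull_le (-s) 1 _ (by
        rintro _ ⟨v, hv, rfl⟩
        have := g1 _ (hVK v hv)
        have e : (-s) * intVec v 0 + 1 * intVec v 1 = (v 1 : ℝ) - s * v 0 := by
          simp [intVec]; ring
        rw [e]; exact this) z hz
      linarith
    · obtain ⟨z, hz, h0, h1⟩ := hKV k hk
      exact ⟨z, hz, by rw [h0, h1, hke]⟩
  all_goals simp only [abs_le]
  · omega
  · omega
  · omega
  · push_cast; omega
  · push_cast; omega
  · push_cast; omega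
  · push_cast; omega

lemma LatticeEquiv.refl' {d : ℕ} (P : Set (Fin d → ℝ)) : LatticeEquiv d P P :=
  ⟨AffineEquiv.refl ℝ _, by simp, by simp⟩

lemma LatticeEquiv.symm' {d : ℕ} {P Q : Set (Fin d → ℝ)} (h : LatticeEquiv d P Q) :
    LatticeEquiv d Q P := by
  obtain ⟨σ, h1, h2⟩ := h
  refine ⟨σ.symm, ?_, ?_⟩
  · conv_lhs => rw [← h1]
    rw [Set.image_image]; simp
  · rw [h2, Set.image_image]; simp

lemma LatticeEquiv.trans' {d : ℕ} {P Q R : Set (Fin d → ℝ)} (h : LatticeEquiv d P Q)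
    (h' : LatticeEquiv d Q R) : LatticeEquiv d P R := by
  obtain ⟨σ, h1, h2⟩ := h
  obtain ⟨τ, h3, h4⟩ := h'
  refine ⟨σ.trans τ, ?_, ?_⟩
  · rw [AffineEquiv.coe_trans, Set.image_comp, h1, h3]
  · rw [AffineEquiv.coe_trans, Set.image_comp, ← h2, h4]

lemma intVec_inj {d : ℕ} : Function.Injective (intVec (d := d)) := by
  intro x y h
  ext i
  have := congrFun h i
  simpa [intVec] using this

lemma LatticeEquiv.poly {d : ℕ} {P Q : Set (Fin d → ℝ)} (h : LatticeEquiv d P Q)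
    (hP : IsConvexLatticePolytope d P) : IsConvexLatticePolytope d Q := by
  classical
  obtain ⟨σ, h1, h2⟩ := h
  obtain ⟨V, hV⟩ := hP
  have hx : ∀ v : Fin d → ℤ, ∃ u : Fin d → ℤ, intVec u = σ (intVec v) := by
    intro v
    have : σ (intVec v) ∈ latticeSet d := by rw [← h1]; exact ⟨_, ⟨v, rfl⟩, rfl⟩
    exact this
  choose g hg using hx
  refine ⟨V.image g, ?_⟩
  rw [h2, hV]
  have := AffineMap.image_convexHull (σ : (Fin d → ℝ) →ᵃ[ℝ] (Fin d → ℝ)) (intVec '' (V : Set (Fin d → ℤ)))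
  simp only [AffineEquiv.coe_toAffineMap] at this
  rw [this]
  congr 1
  ext z
  simp only [Set.mem_image, Finset.coe_image]
  constructor
  · rintro ⟨_, ⟨v, hv, rfl⟩, rfl⟩
    exact ⟨g v, ⟨v, hv, rfl⟩, hg v⟩
  · rintro ⟨_, ⟨v, hv, rfl⟩, rfl⟩
    exact ⟨_, ⟨v, hv, rfl⟩, (hg v).symm⟩

lemma LatticeEquiv.full {d : ℕ} {P Q : Set (Fin d → ℝ)} (h : LatticeEquiv d P Q)
    (hP : IsFullDim d P) : IsFullDim d Q := by
  obtain ⟨σ, h1, h2⟩ := h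
  unfold IsFullDim at *
  rw [h2]
  exact (AffineEquiv.span_eq_top_iff σ).1 hP

lemma LatticeEquiv.ncard {d : ℕ} {P Q : Set (Fin d → ℝ)} (h : LatticeEquiv d P Q) :
    (latticePts d P).ncard = (latticePts d Q).ncard := by
  obtain ⟨σ, h1, h2⟩ := h
  have e : ∀ R : Set (Fin d → ℝ), (latticePts d R).ncard = (R ∩ latticeSet d).ncard := by
    intro R
    rw [← Set.ncard_image_of_injective _ intVec_inj]
    congr 1
    ext z
    constructor
    · rintro ⟨v, hv, rfl⟩; exact ⟨hv, v, rfl⟩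
    · rintro ⟨hz, v, rfl⟩; exact ⟨v, hz, rfl⟩
  rw [e, e, h2]
  conv_rhs => rw [← h1]
  rw [← Set.image_inter σ.injective, Set.ncard_image_of_injective _ σ.injective]

lemma poly_closed {d : ℕ} {P : Set (Fin d → ℝ)} (hP : IsConvexLatticePolytope d P) :
    Convex ℝ P ∧ IsCompact P := by
  obtain ⟨V, rfl⟩ := hP
  exact ⟨convex_convexHull ℝ _, ((V.finite_toSet).image _).isCompact_convexHull ℝ⟩

lemma full_nonempty {d : ℕ} {P : Set (Fin d → ℝ)} (hP : IsFullDim d P) : P.Nonempty := by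
  rw [Set.nonempty_iff_ne_empty]
  rintro rfl
  unfold IsFullDim at hP
  rw [AffineSubspace.span_empty] at hP
  exact AffineSubspace.bot_ne_top ℝ _ _ hP

lemma attain {P : Set (Fin 2 → ℝ)} (hP : IsConvexLatticePolytope 2 P) (hne : P.Nonempty)
    (i : Fin 2) : ∃ v : Fin 2 → ℤ, intVec v ∈ P ∧ ∀ z ∈ P, z i ≤ v i := by
  obtain ⟨V, rfl⟩ := hP
  have hVne : V.Nonempty := by
    by_contra h
    rw [Finset.not_nonempty_iff_eq_empty] at h
    simp [h] at hne
  obtain ⟨v, hv, hmax⟩ := Finset.exists_max_image V (fun v => v i) hVne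
  refine ⟨v, subset_convexHull ℝ _ ⟨v, hv, rfl⟩, fun z hz => ?_⟩
  have hm : ∀ u ∈ V, ((u i : ℤ) : ℝ) ≤ v i := fun u hu => by exact_mod_cast hmax u hu
  fin_cases i
  · have := hull_le 1 0 (v 0 : ℝ) (by
      rintro _ ⟨u, hu, rfl⟩
      simpa [intVec] using hmax u hu) z hz
    simpa using this
  · have := hull_le 0 1 (v 1 : ℝ) (by
      rintro _ ⟨u, hu, rfl⟩
      simpa [intVec] using hmax u hu) z hz
    simpa using this

lemma mk_LE {d : ℕ} (P : Set (Fin d → ℝ)) (σ : (Fin d → ℝ) ≃ᵃ[ℝ] (Fin d → ℝ))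
    (h1 : ∀ v : Fin d → ℤ, ∃ u, σ (intVec v) = intVec u)
    (h2 : ∀ v : Fin d → ℤ, ∃ u, σ.symm (intVec v) = intVec u) : LatticeEquiv d P (σ '' P) := by
  refine ⟨σ, ?_, rfl⟩
  apply Set.Subset.antisymm
  · rintro _ ⟨_, ⟨v, rfl⟩, rfl⟩
    obtain ⟨u, hu⟩ := h1 v
    exact ⟨u, hu.symm⟩
  · rintro _ ⟨v, rfl⟩
    obtain ⟨u, hu⟩ := h2 v
    refine ⟨intVec u, ⟨u, rfl⟩, ?_⟩
    rw [← hu]; simp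

def shearE (k : ℤ) : (Fin 2 → ℝ) ≃ₗ[ℝ] (Fin 2 → ℝ) where
  toFun v := ![v 0, v 1 + k * v 0]
  invFun v := ![v 0, v 1 - k * v 0]
  map_add' x y := by ext i; fin_cases i <;> simp; ring
  map_smul' c x := by ext i; fin_cases i <;> simp; ring
  left_inv x := by ext i; fin_cases i <;> simp
  right_inv x := by ext i; fin_cases i <;> simp

def swapE : (Fin 2 → ℝ) ≃ₗ[ℝ] (Fin 2 → ℝ) where
  toFun v := ![v 1, v 0]
  invFun v := ![v 1, v 0]
  map_add' x y := by ext i; fin_cases i <;> simp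
  map_smul' c x := by ext i; fin_cases i <;> simp
  left_inv x := by ext i; fin_cases i <;> simp
  right_inv x := by ext i; fin_cases i <;> simp

lemma shear_LE (P : Set (Fin 2 → ℝ)) (k : ℤ) : LatticeEquiv 2 P (shearE k '' P) := by
  refine mk_LE P (shearE k).toAffineEquiv (fun v => ⟨![v 0, v 1 + k * v 0], ?_⟩)
    (fun v => ⟨![v 0, v 1 - k * v 0], ?_⟩)
  · change ![_, _] = _
    ext i; fin_cases i <;> simp [intVec]
  · change ![_, _] = _
    ext i; fin_cases i <;> simp [intVec]

lemma swap_LE (P : Set (Fin 2 → ℝ)) : LatticeEquiv 2 P (swapE '' P) := by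
  refine mk_LE P swapE.toAffineEquiv (fun v => ⟨![v 1, v 0], ?_⟩) (fun v => ⟨![v 1, v 0], ?_⟩)
  · change ![_, _] = _
    ext i; fin_cases i <;> simp [intVec]
  · change ![_, _] = _
    ext i; fin_cases i <;> simp [intVec]

lemma sym_image {P : Set (Fin 2 → ℝ)} (f : (Fin 2 → ℝ) ≃ₗ[ℝ] (Fin 2 → ℝ))
    (h : ∀ z ∈ P, -z ∈ P) : ∀ z ∈ f '' P, -z ∈ f '' P := by
  rintro _ ⟨z, hz, rfl⟩
  exact ⟨-z, h z hz, by simp⟩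

lemma center {P : Set (Fin 2 → ℝ)} (hP : IsConvexLatticePolytope 2 P) (hf : IsFullDim 2 P)
    (hs : IsCentrallySymmetric 2 P) (hw : Odd (latticePts 2 P).ncard) :
    ∃ P', LatticeEquiv 2 P P' ∧ ∀ z ∈ P', -z ∈ P' := by
  obtain ⟨c, hc⟩ := hs
  -- 2c is integral
  have h2c : ∃ t : Fin 2 → ℤ, intVec t = (2 : ℝ) • c := by
    obtain ⟨v, hv⟩ := (poly_closed hP).2.extremePoints_nonempty (full_nonempty hf)
    have hv' : (2 : ℝ) • c - v ∈ P.extremePoints ℝ := by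
      rw [mem_extremePoints] at hv ⊢
      refine ⟨(hc v).1 hv.1, fun x1 h1 x2 h2 hx => ?_⟩
      have := hv.2 _ ((hc x1).1 h1) _ ((hc x2).1 h2) (by
        obtain ⟨p, q, hp, hq, hpq, e⟩ := hx
        refine ⟨p, q, hp, hq, hpq, ?_⟩
        have : v = (2 : ℝ) • c - (p • x1 + q • x2) := by rw [e]; abel
        rw [this, smul_sub, smul_sub]
        have : (2 : ℝ) • c = p • ((2 : ℝ) • c) + q • ((2 : ℝ) • c) := by
          rw [← add_smul, hpq, one_smul]
        conv_rhs => rw [this]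
        abel)
      constructor
      · rw [← this.1]; abel
      · rw [← this.2]; abel
    obtain ⟨V, rfl⟩ := hP
    obtain ⟨x, -, hx⟩ := extremePoints_convexHull_subset hv
    obtain ⟨y, -, hy⟩ := extremePoints_convexHull_subset hv'
    refine ⟨x + y, ?_⟩
    have : intVec (x + y) = intVec x + intVec y := by ext i; simp [intVec]
    rw [this, hx, hy]; abel
  obtain ⟨t, ht⟩ := h2c
  have hfin : (latticePts 2 P).Finite := by
    apply Set.finite_of_ncard_ne_zero
    intro h; rw [h] at hw; simp at hw
  have hsub : ∀ x ∈ latticePts 2 P, t - x ∈ latticePts 2 P := by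
    intro x hx
    have := (hc _).1 hx
    rw [← ht] at this
    have e : intVec (t - x) = intVec t - intVec x := by ext i; simp [intVec]
    change intVec (t - x) ∈ P
    rw [e]; exact this
  have : Fintype (latticePts 2 P) := hfin.fintype
  let τ : Equiv.Perm (latticePts 2 P) :=
    ⟨fun x => ⟨t - x.1, hsub _ x.2⟩, fun x => ⟨t - x.1, hsub _ x.2⟩,
      fun x => by ext; simp, fun x => by ext; simp⟩
  have : Fact (Nat.Prime 2) := ⟨Nat.prime_two⟩
  obtain ⟨k, hk⟩ := Equiv.Perm.exists_fixed_point_of_prime (p := 2) (n := 1) (σ := τ) (by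
      rw [← Nat.card_eq_fintype_card, Nat.card_coe_set_eq]
      exact hw.not_two_dvd_nat) (by
      ext x : 1
      simp only [pow_one, sq, Equiv.Perm.mul_apply, Equiv.Perm.one_apply]
      ext; simp [τ])
  have hk' : t - k.1 = k.1 := congrArg Subtype.val hk
  have hck : c = intVec k.1 := by
    ext i
    have h1 := congrFun ht i
    have h2 := congrFun hk' i
    simp [intVec] at h1 h2 ⊢
    have h3 : t i = 2 * k.1 i := by omega
    rw [h3] at h1; push_cast at h1; linarith
  refine ⟨_, mk_LE P (AffineEquiv.constVAdd ℝ (Fin 2 → ℝ) (-intVec k.1))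
    (fun v => ⟨-k.1 + v, ?_⟩) (fun v => ⟨k.1 + v, ?_⟩), ?_⟩
  · ext i; simp [intVec]
  · ext i; simp [intVec, AffineEquiv.constVAdd_symm]
  · rintro _ ⟨z, hz, rfl⟩
    refine ⟨_, (hc z).1 hz, ?_⟩
    rw [hck]
    simp only [AffineEquiv.constVAdd_apply, vadd_eq_add]
    rw [two_smul]; abel

lemma det_arith (a b c x D M N dx dy : ℤ) (ha1 : 1 ≤ a) (hab : a ≤ b) (hcc : 2 * |c| ≤ a)
    (hx : |x| ≤ a) (hD : D = a * b - c * x) (hD0 : 0 < D) (hD2 : a * b ≤ 2 * D)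
    (edx : dx = M * a + N * x) (edy : dy = M * c + N * b) (hdxb : 4 * |dx| < a)
    (hdyb : 4 * |dy| < b) : M = 0 ∧ N = 0 := by
  have hMD : M * D = dx * b - dy * x := by rw [edx, edy, hD]; ring
  have hND : N * D = dy * a - dx * c := by rw [edx, edy, hD]; ring
  have small : ∀ T : ℤ, |T * D| < D → T = 0 := by
    intro T hT
    rw [abs_mul, abs_of_pos hD0] at hT
    have : |T| < 1 := by
      by_contra h
      push Not at h
      have := mul_le_mul_of_nonneg_right h hD0.le
      linarith
    exact Int.abs_lt_one_iff.1 this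
  have hb0 : 0 < b := by linarith
  have bd : ∀ p q r t : ℤ, |p * q - r * t| ≤ |p| * |q| + |r| * |t| := by
    intro p q r t
    refine (abs_sub _ _).trans ?_
    rw [abs_mul, abs_mul]
  constructor
  · apply small
    rw [hMD]
    have t1 := bd dx b dy x
    rw [abs_of_pos hb0] at t1
    have t2 : 4 * |dx| * b < a * b := mul_lt_mul_of_pos_right hdxb hb0
    have t3 : 4 * |dy| * |x| ≤ b * a := mul_le_mul hdyb.le hx (abs_nonneg _) hb0.le
    linarith
  · apply small
    rw [hND]
    have t1 := bd dy a dx c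
    rw [abs_of_pos (by linarith : 0 < a)] at t1
    have t2 : 4 * |dy| * a < b * a := mul_lt_mul_of_pos_right hdyb (by linarith)
    have t3 : 4 * |dx| * |c| ≤ a * b := mul_le_mul hdxb.le (by linarith [abs_nonneg c])
      (abs_nonneg _) (by linarith)
    linarith

lemma count_lower {P : Set (Fin 2 → ℝ)} (hc : Convex ℝ P) (hs : ∀ z ∈ P, -z ∈ P)
    (hfin : (latticePts 2 P).Finite) (v1 v2 : Fin 2 → ℤ) (h1 : intVec v1 ∈ P) (h2 : intVec v2 ∈ P)
    (a b : ℕ) (ha : v1 0 = a) (hb : v2 1 = b) (ha1 : 1 ≤ a) (hab : a ≤ b)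
    (hcc : 2 * |v1 1| ≤ a) (hx : |v2 0| ≤ a) : a * b ≤ 16 * (latticePts 2 P).ncard := by
  set c := v1 1 with hcdef
  set x := v2 0 with hxdef
  set D : ℤ := a * b - c * x with hD
  have hab' : (a : ℤ) ≤ b := by exact_mod_cast hab
  have ha1' : (1 : ℤ) ≤ a := by exact_mod_cast ha1
  have hcx : 2 * |c * x| ≤ a * b := by
    rw [abs_mul]
    nlinarith [abs_nonneg c, abs_nonneg x]
  have hD2 : (a : ℤ) * b ≤ 2 * D := by
    have := le_abs_self (c * x)
    rw [hD]; linarith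
  have hD0 : 0 < D := by nlinarith
  have hDR : (0 : ℝ) < D := by exact_mod_cast hD0
  have hmem : ∀ s t : ℝ, |s| ≤ 1 / 2 → |t| ≤ 1 / 2 → s • intVec v1 + t • intVec v2 ∈ P := by
    intro s t hs' ht'
    have half : ∀ (r : ℝ) (u : Fin 2 → ℝ), u ∈ P → |r| ≤ 1 / 2 → (2 * r) • u ∈ P := by
      intro r u hu hr
      rw [abs_le] at hr
      have := hc hu (hs u hu) (a := 1 / 2 + r) (b := 1 / 2 - r) (by linarith) (by linarith) (by ring)
      convert this using 1
      ext i; simp; ring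
    have := hc (half s _ h1 hs') (half t _ h2 ht') (a := 1 / 2) (b := 1 / 2) (by norm_num)
      (by norm_num) (by norm_num)
    convert this using 1
    ext i; simp; ring
  let A := (a + 3) / 4
  let B := (b + 3) / 4
  let m : Fin A × Fin B → ℤ := fun p =>
    round ((((p.1 : ℕ) : ℝ) * b - ((p.2 : ℕ) : ℝ) * x) / D)
  let n : Fin A × Fin B → ℤ := fun p =>
    round ((((p.2 : ℕ) : ℝ) * a - ((p.1 : ℕ) : ℝ) * c) / D)
  let g : Fin A × Fin B → (Fin 2 → ℤ) := fun p =>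
    ![((p.1 : ℕ) : ℤ) - m p * a - n p * x, ((p.2 : ℕ) : ℤ) - m p * c - n p * b]
  have hg : ∀ p, g p ∈ latticePts 2 P := by
    intro p
    have := hmem ((((p.1 : ℕ) : ℝ) * b - ((p.2 : ℕ) : ℝ) * x) / D - m p)
      ((((p.2 : ℕ) : ℝ) * a - ((p.1 : ℕ) : ℝ) * c) / D - n p) (abs_sub_round _) (abs_sub_round _)
    change intVec (g p) ∈ P
    convert this using 1
    have hDe : (D : ℝ) = a * b - c * x := by rw [hD]; push_cast; ring
    have hne : (D : ℝ) ≠ 0 := hDR.ne'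
    ext i
    fin_cases i
    · simp [intVec, g, ha, ← hxdef]
      field_simp
      rw [hDe]; ring
    · simp [intVec, g, hb, ← hcdef]
      field_simp
      rw [hDe]; ring
  have hinj : Function.Injective g := by
    rintro p p' h
    have e0 := congrFun h 0
    have e1 := congrFun h 1
    simp only [g, Matrix.cons_val_zero, Matrix.cons_val_one] at e0 e1
    set M := m p - m p' with hM
    set N := n p - n p' with hN
    obtain ⟨⟨i, hi⟩, ⟨j, hj⟩⟩ := p
    obtain ⟨⟨i', hi'⟩, ⟨j', hj'⟩⟩ := p'
    simp only at e0 e1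
    have hi4 : 4 * (i : ℤ) < a := by simp only [A] at hi; omega
    have hi4' : 4 * (i' : ℤ) < a := by simp only [A] at hi'; omega
    have hj4 : 4 * (j : ℤ) < b := by simp only [B] at hj; omega
    have hj4' : 4 * (j' : ℤ) < b := by simp only [B] at hj'; omega
    set dx : ℤ := i - i' with hdx
    set dy : ℤ := j - j' with hdy
    have edx : dx = M * a + N * x := by rw [hdx, hM, hN]; linarith
    have edy : dy = M * c + N * b := by rw [hdy, hM, hN]; linarith
    have hdxb : 4 * |dx| < a := by
      rcases abs_cases dx with h | h <;> omega
    have hdyb : 4 * |dy| < b := by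
      rcases abs_cases dy with h | h <;> omega
    obtain ⟨hM0, hN0⟩ := det_arith a b c x D M N dx dy ha1' hab' hcc hx hD hD0 hD2 edx edy hdxb hdyb
    rw [hM0, hN0] at edx edy
    simp only [Prod.mk.injEq, Fin.mk.injEq]
    constructor <;> omega
  have hcard : A * B ≤ (latticePts 2 P).ncard := by
    have h1 : (Set.range g).ncard = A * B := by
      rw [Set.ncard_range_of_injective hinj]; simp
    rw [← h1]
    exact Set.ncard_le_ncard (by rintro _ ⟨p, rfl⟩; exact hg p) hfin
  have hA : a ≤ 4 * A := by simp only [A]; omega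
  have hB : b ≤ 4 * B := by simp only [B]; omega
  calc a * b ≤ (4 * A) * (4 * B) := Nat.mul_le_mul hA hB
    _ = 16 * (A * B) := by ring
    _ ≤ _ := by omega

lemma reduce {P : Set (Fin 2 → ℝ)} (hP : IsConvexLatticePolytope 2 P) (hf : IsFullDim 2 P)
    (hs : IsCentrallySymmetric 2 P) (w : ℕ) (hw : Odd w) (hn : (latticePts 2 P).ncard = w) :
    ∃ (P' : Set (Fin 2 → ℝ)) (a b : ℕ), LatticeEquiv 2 P P' ∧ (∀ z ∈ P', -z ∈ P') ∧
      1 ≤ a ∧ 1 ≤ b ∧ a * b ≤ 16 * w ∧ ∀ z ∈ P', |z 0| ≤ a ∧ |z 1| ≤ b := by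
  classical
  have hex : ∃ a : ℕ, ∃ P', LatticeEquiv 2 P P' ∧ (∀ z ∈ P', -z ∈ P') ∧ ∀ z ∈ P', z 0 ≤ a := by
    obtain ⟨P', h1, h2⟩ := center hP hf hs (by rw [hn]; exact hw)
    obtain ⟨v, hv, hv2⟩ := attain (h1.poly hP) (full_nonempty (h1.full hf)) 0
    refine ⟨(v 0).toNat, P', h1, h2, fun z hz => (hv2 z hz).trans ?_⟩
    exact_mod_cast Int.self_le_toNat (v 0)
  set a := Nat.find hex with ha
  obtain ⟨Q, hQ1, hQ2, hQ3⟩ := Nat.find_spec hex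
  have hmin : ∀ (a' : ℕ) (R : Set (Fin 2 → ℝ)), LatticeEquiv 2 P R → (∀ z ∈ R, -z ∈ R) →
      (∀ z ∈ R, z 0 ≤ a') → a ≤ a' := fun a' R r1 r2 r3 => Nat.find_min' hex ⟨R, r1, r2, r3⟩
  rw [← ha] at hQ3
  have nonneg : ∀ R : Set (Fin 2 → ℝ), (∀ z ∈ R, -z ∈ R) → ∀ (v : Fin 2 → ℤ) (i : Fin 2),
      intVec v ∈ R → (∀ z ∈ R, z i ≤ v i) → 0 ≤ v i := by
    intro R hR v i hv hm
    have := hm _ (hR _ hv)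
    simp [intVec] at this
    exact_mod_cast this
  obtain ⟨u, hu, hu2⟩ := attain (hQ1.poly hP) (full_nonempty (hQ1.full hf)) 0
  have hu0 := nonneg Q hQ2 u 0 hu hu2
  have hua : u 0 = a := by
    apply le_antisymm
    · have := hQ3 _ hu
      simp only [intVec] at this
      exact_mod_cast this
    · have := hmin (u 0).toNat Q hQ1 hQ2 (fun z hz => (hu2 z hz).trans (by
        exact_mod_cast Int.self_le_toNat (u 0)))
      omega
  have ha1 : 1 ≤ a := by
    by_contra h0
    have h0 : a = 0 := by omega
    have hz : Q ⊆ ((LinearMap.ker (LinearMap.proj (R := ℝ) (φ := fun _ : Fin 2 => ℝ) 0)).toAffineSubspace :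
        Set (Fin 2 → ℝ)) := by
      intro z hz
      have h1 := hQ3 z hz
      have h2 := hQ3 _ (hQ2 z hz)
      rw [h0] at h1 h2
      simp at h1 h2 ⊢
      linarith
    have h3 := affineSpan_le.2 hz
    have hfull := hQ1.full hf
    unfold IsFullDim at hfull
    rw [hfull] at h3
    have := h3 (AffineSubspace.mem_top ℝ _ (fun _ => (1 : ℝ)))
    simp at this
  -- shear
  obtain ⟨k, hk⟩ : ∃ k : ℤ, 2 * |u 1 + k * a| ≤ a := by
    refine ⟨-((2 * u 1 + a) / (2 * a)), ?_⟩
    have h1 := Int.emod_add_mul_ediv (2 * u 1 + a) (2 * a)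
    have h2 := Int.emod_nonneg (2 * u 1 + a) (b := 2 * a) (by omega)
    have h3 := Int.emod_lt_of_pos (2 * u 1 + a) (b := 2 * a) (by omega)
    have h4 : |u 1 + -((2 * u 1 + a) / (2 * a)) * a| * 2 = |2 * (u 1 + -((2 * u 1 + a) / (2 * a)) * a)| := by
      rw [abs_mul]; norm_num; ring
    rw [mul_comm, h4, abs_le]
    constructor <;> nlinarith
  set R := shearE k '' Q with hR
  have hR1 : LatticeEquiv 2 P R := hQ1.trans' (shear_LE Q k)
  have hR2 : ∀ z ∈ R, -z ∈ R := sym_image _ hQ2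
  have hR3 : ∀ z ∈ R, z 0 ≤ a := by
    rintro _ ⟨z, hz, rfl⟩
    have := hQ3 z hz
    simpa [shearE] using this
  have hRne := full_nonempty (hR1.full hf)
  obtain ⟨v, hv, hv2⟩ := attain (hR1.poly hP) hRne 1
  have hv0 := nonneg R hR2 v 1 hv hv2
  have hb : v 1 = ((v 1).toNat : ℤ) := by omega
  have hab : a ≤ (v 1).toNat := by
    refine hmin _ (swapE '' R) (hR1.trans' (swap_LE R)) (sym_image _ hR2) ?_
    rintro _ ⟨z, hz, rfl⟩
    have : z 1 ≤ ((v 1).toNat : ℝ) :=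
      (hv2 z hz).trans (by exact_mod_cast Int.self_le_toNat (v 1))
    exact this
  have absle : ∀ z ∈ R, |z 0| ≤ a ∧ |z 1| ≤ ((v 1).toNat : ℕ) := by
    intro z hz
    have e1 := hR3 z hz
    have e2 := hR3 _ (hR2 z hz)
    have e3 := hv2 z hz
    have e4 := hv2 _ (hR2 z hz)
    rw [hb] at e3 e4
    simp only [Pi.neg_apply, Int.cast_natCast] at e2 e3 e4
    exact ⟨abs_le.2 ⟨by linarith, by linarith⟩, abs_le.2 ⟨by linarith, by linarith⟩⟩
  refine ⟨R, a, (v 1).toNat, hR1, hR2, ha1, by omega, ?_, absle⟩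
  rw [← hn, hR1.ncard]
  have hfin : (latticePts 2 R).Finite := by
    apply Set.finite_of_ncard_ne_zero
    rw [← hR1.ncard, hn]
    rintro rfl; simp at hw
  refine count_lower (poly_closed (hR1.poly hP)).1 hR2 hfin ![u 0, u 1 + k * u 0] v ?_ hv a _
    (by simpa using hua) hb ha1 hab (by simpa [hua] using hk) ?_
  · refine ⟨intVec u, hu, ?_⟩
    ext i; fin_cases i <;> simp [shearE, intVec]
  · have := (absle _ hv).1
    simp only [intVec] at this
    exact_mod_cast this

lemma zc_nonneg : 0 ≤ zc := tsum_nonneg fun k => by positivity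

def TC (w a b : ℕ) : Set Code :=
  (((Set.Icc (-(16 * w : ℤ)) (16 * w)) ×ˢ (Set.Icc (-(16 * w : ℤ)) (16 * w)) ×ˢ
    (Set.Icc (0 : ℤ) (32 * w)))) ×ˢ (BP (2 * a) (2 * b) ×ˢ BP (2 * a) (2 * b))

lemma TC_bound (w a b : ℕ) (ha : 1 ≤ a) (hb : 1 ≤ b) (hab : a * b ≤ 16 * w) :
    (TC w a b).Finite ∧ ((TC w a b).ncard : ℝ) ≤
      (32 * w + 1) ^ 3 * Real.exp (8 * (2 + zc) * (w : ℝ) ^ ((1 : ℝ) / 3)) := by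
  obtain ⟨f, hf⟩ := BP_bound (2 * a) (2 * b) (by omega) (by omega)
  constructor
  · exact ((Set.finite_Icc _ _).prod ((Set.finite_Icc _ _).prod (Set.finite_Icc _ _))).prod (f.prod f)
  · unfold TC
    rw [Set.ncard_prod, Set.ncard_prod, Set.ncard_prod, Set.ncard_prod]
    have e1 : (Set.Icc (-(16 * w : ℤ)) (16 * w)).ncard = 32 * w + 1 := by
      rw [← Nat.card_coe_set_eq]; simp; omega
    have e2 : (Set.Icc (0 : ℤ) (32 * w)).ncard = 32 * w + 1 := by
      rw [← Nat.card_coe_set_eq]; simp; omega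
    rw [e1, e2]
    push_cast
    have hL : (((2 * a : ℕ) : ℝ) * ((2 * b : ℕ) : ℝ)) ^ ((1 : ℝ) / 3) ≤ 4 * (w : ℝ) ^ ((1 : ℝ) / 3) := by
      have h4 : (4 : ℝ) = (64 : ℝ) ^ ((1 : ℝ) / 3) := by
        rw [show (64 : ℝ) = 4 ^ (3 : ℝ) by norm_num, ← Real.rpow_mul (by norm_num)]; norm_num
      rw [h4, ← Real.mul_rpow (by norm_num) (by positivity)]
      apply Real.rpow_le_rpow (by positivity) _ (by norm_num)
      have : (a : ℝ) * b ≤ 16 * w := by exact_mod_cast hab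
      push_cast; linarith
    have hf' : ((BP (2 * a) (2 * b)).ncard : ℝ) ≤
        Real.exp ((2 + zc) * (4 * (w : ℝ) ^ ((1 : ℝ) / 3))) := by
      refine hf.trans (Real.exp_le_exp.2 ?_)
      exact mul_le_mul_of_nonneg_left hL (by linarith [zc_nonneg])
    calc _ ≤ (32 * (w : ℝ) + 1) * ((32 * w + 1) * (32 * w + 1)) *
          (Real.exp ((2 + zc) * (4 * (w : ℝ) ^ ((1 : ℝ) / 3))) *
           Real.exp ((2 + zc) * (4 * (w : ℝ) ^ ((1 : ℝ) / 3)))) := by gcongr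
      _ = _ := by
        rw [← Real.exp_add]
        have : (2 + zc) * (4 * (w : ℝ) ^ ((1 : ℝ) / 3)) + (2 + zc) * (4 * (w : ℝ) ^ ((1 : ℝ) / 3))
          = 8 * (2 + zc) * (w : ℝ) ^ ((1 : ℝ) / 3) := by ring
        rw [this]; ring

abbrev QC (w : ℕ) := ClassesType 2 (fun P => IsCentrallySymmetric 2 P ∧
        (latticePts 2 P).ncard = w)

lemma upper (w : ℕ) (hw : Odd w) :
    Finite (QC w) ∧ (Nat.card (QC w) : ℝ) ≤
      Real.exp ((8 * (2 + zc) + 45) * (w : ℝ) ^ ((1 : ℝ) / 3)) := by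
  classical
  have hw1 : 1 ≤ w := hw.pos
  let G : Finset (ℕ × ℕ) := ((Finset.Icc 1 (16 * w)) ×ˢ (Finset.Icc 1 (16 * w))).filter
    (fun p => p.1 * p.2 ≤ 16 * w)
  have hG : ∀ p ∈ G, 1 ≤ p.1 ∧ 1 ≤ p.2 ∧ p.1 * p.2 ≤ 16 * w := by
    intro p hp
    simp only [G, Finset.mem_filter, Finset.mem_product, Finset.mem_Icc] at hp
    omega
  have hGc : G.card ≤ (16 * w) * (16 * w) := by
    refine (Finset.card_filter_le _ _).trans ?_
    simp
  let T : Finset Code := G.attach.biUnion (fun p =>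
    (TC_bound w p.1.1 p.1.2 (hG _ p.2).1 (hG _ p.2).2.1 (hG _ p.2).2.2).1.toFinset)
  have key : ∀ q : QC w, ∃ c : Code, c ∈ T ∧ ∃ P P', ∃ hP, q = Quot.mk _ ⟨P, hP⟩ ∧
      LatticeEquiv 2 P P' ∧ IsCode P' c ∧ (∀ z ∈ P', -z ∈ P') := by
    intro q
    induction q using Quot.ind with
    | _ P =>
    obtain ⟨P, h1, h2, h3, h4⟩ := P
    obtain ⟨P', a, b, g1, g2, ha, hb, hab, hbox⟩ := reduce h1 h2 h3 w hw h4
    obtain ⟨c, c1, c2, c3, c4, c5, c6, c7⟩ := exists_code (g1.poly h1) (full_nonempty (g1.full h2)) a b hbox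
    have ha' : a ≤ 16 * w := by nlinarith
    have hb' : b ≤ 16 * w := by nlinarith
    refine ⟨c, ?_, P, P', ⟨h1, h2, h3, h4⟩, rfl, g1, c1, g2⟩
    simp only [T, Finset.mem_biUnion, Finset.mem_attach, true_and]
    refine ⟨⟨(a, b), by simp [G, ha, hb, ha', hb', hab]⟩, ?_⟩
    rw [Set.Finite.mem_toFinset]
    rw [abs_le] at c2 c3
    refine ⟨⟨⟨?_, ?_⟩, ⟨?_, ?_⟩, ⟨c4, ?_⟩⟩, c6, c7⟩ <;> omega
  choose F hF1 hF2 using key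
  have hinj : Function.Injective (fun q => (⟨F q, hF1 q⟩ : T)) := by
    intro q q' h
    have h : F q = F q' := congrArg Subtype.val h
    obtain ⟨P, P', hP, e, g1, g2, g3⟩ := hF2 q
    obtain ⟨R, R', hR, e', g1', g2', g3'⟩ := hF2 q'
    rw [← h] at g2'
    have cP := poly_closed (g1.poly hP.1)
    have cR := poly_closed (g1'.poly hR.1)
    have : P' = R' := Set.Subset.antisymm
      (g2.subset g2' g3 g3' cR.1 cR.2.isClosed) (g2'.subset g2 g3' g3 cP.1 cP.2.isClosed)
    rw [e, e']
    apply Quot.sound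
    change LatticeEquiv 2 P R
    rw [← this] at g1'
    exact g1.trans' g1'.symm'
  refine ⟨Finite.of_injective _ hinj, ?_⟩
  have hc1 : Nat.card (QC w) ≤ T.card := by
    have := Nat.card_le_card_of_injective _ hinj
    simpa using this
  have hT : (T.card : ℝ) ≤ (16 * w) * (16 * w) * ((32 * w + 1) ^ 3 *
      Real.exp (8 * (2 + zc) * (w : ℝ) ^ ((1 : ℝ) / 3))) := by
    have h1 : (T.card : ℝ) ≤ ∑ p ∈ G.attach, ((32 * w + 1) ^ 3 *
      Real.exp (8 * (2 + zc) * (w : ℝ) ^ ((1 : ℝ) / 3))) := by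
      have h0 : (T.card : ℝ) ≤ ∑ p ∈ G.attach, (((TC_bound w p.1.1 p.1.2 (hG _ p.2).1 (hG _ p.2).2.1
        (hG _ p.2).2.2).1.toFinset.card : ℕ) : ℝ) := by
        exact_mod_cast Finset.card_biUnion_le
      refine h0.trans (Finset.sum_le_sum fun p _ => ?_)
      rw [← Set.ncard_eq_toFinset_card _ (TC_bound w p.1.1 p.1.2 (hG _ p.2).1 (hG _ p.2).2.1
        (hG _ p.2).2.2).1]
      exact (TC_bound w p.1.1 p.1.2 (hG _ p.2).1 (hG _ p.2).2.1 (hG _ p.2).2.2).2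
    refine h1.trans ?_
    rw [Finset.sum_const, nsmul_eq_mul, Finset.card_attach]
    apply mul_le_mul_of_nonneg_right _ (by positivity)
    exact_mod_cast hGc
  have hwR : (1 : ℝ) ≤ w := by exact_mod_cast hw1
  set L := (w : ℝ) ^ ((1 : ℝ) / 3) with hL
  have hL1 : 1 ≤ L := Real.one_le_rpow hwR (by norm_num)
  have hL3 : (w : ℝ) = L ^ 3 := by
    rw [hL, ← Real.rpow_natCast, ← Real.rpow_mul (by positivity)]; norm_num
  have hpoly : 33 * (w : ℝ) ≤ Real.exp (9 * L) := by
    have h1 : L ≤ Real.exp L := by linarith [Real.add_one_le_exp L]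
    have h2 : (2 : ℝ) ≤ Real.exp L := by linarith [Real.add_one_le_exp L]
    have h3 : (1 : ℝ) ≤ Real.exp L := by linarith
    have e5 : (2 : ℝ) ^ 6 ≤ Real.exp L ^ 6 := pow_le_pow_left₀ (by norm_num) h2 6
    have e3 : L ^ 3 ≤ Real.exp L ^ 3 := pow_le_pow_left₀ (by linarith) h1 3
    calc 33 * (w : ℝ) ≤ 2 ^ 6 * L ^ 3 := by
          rw [hL3]; have : 0 ≤ L ^ 3 := by positivity
          nlinarith
      _ ≤ Real.exp L ^ 6 * Real.exp L ^ 3 := by gcongr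
      _ = Real.exp (9 * L) := by
        rw [← pow_add, ← Real.exp_nat_mul]; norm_num
  calc (Nat.card (QC w) : ℝ) ≤ T.card := by exact_mod_cast hc1
    _ ≤ _ := hT
    _ ≤ (33 * w) * (33 * w) * ((33 * w) ^ 3 * Real.exp (8 * (2 + zc) * L)) := by
      gcongr <;> linarith
    _ = (33 * w) ^ 5 * Real.exp (8 * (2 + zc) * L) := by ring
    _ ≤ (Real.exp (9 * L)) ^ 5 * Real.exp (8 * (2 + zc) * L) := by gcongr
    _ = _ := by
      rw [← Real.exp_nat_mul, ← Real.exp_add]; congr 1; push_cast; ring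

def PV (n : ℕ) (f : ℤ → ℤ) : Finset (Fin 2 → ℤ) :=
  (Finset.Icc (-(n : ℤ)) n).image (fun x => ![x, f x]) ∪
  (Finset.Icc (-(n : ℤ)) n).image (fun x => ![x, -f (-x)])

def PF (n : ℕ) (f : ℤ → ℤ) : Set (Fin 2 → ℝ) :=
  convexHull ℝ (intVec '' (PV n f : Set (Fin 2 → ℤ)))

lemma PF_poly (n : ℕ) (f : ℤ → ℤ) : IsConvexLatticePolytope 2 (PF n f) := ⟨_, rfl⟩

lemma PF_top {n : ℕ} {f : ℤ → ℤ} {x : ℤ} (hx : -(n : ℤ) ≤ x ∧ x ≤ n) :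
    ![(x : ℝ), (f x : ℝ)] ∈ PF n f := by
  apply subset_convexHull
  refine ⟨![x, f x], ?_, ?_⟩
  · simp only [PV, Finset.coe_union, Finset.coe_image, Set.mem_union, Set.mem_image]
    left
    exact ⟨x, by simpa using hx, rfl⟩
  · ext i; fin_cases i <;> simp [intVec]

lemma PF_bot {n : ℕ} {f : ℤ → ℤ} {x : ℤ} (hx : -(n : ℤ) ≤ x ∧ x ≤ n) :
    ![(x : ℝ), -(f (-x) : ℝ)] ∈ PF n f := by
  apply subset_convexHull
  refine ⟨![x, -f (-x)], ?_, ?_⟩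
  · simp only [PV, Finset.coe_union, Finset.coe_image, Set.mem_union, Set.mem_image]
    right
    exact ⟨x, by simpa using hx, rfl⟩
  · ext i; fin_cases i <;> simp [intVec]

lemma PF_sym (n : ℕ) (f : ℤ → ℤ) : ∀ z ∈ PF n f, -z ∈ PF n f := by
  have hc : Convex ℝ {z : Fin 2 → ℝ | -z ∈ PF n f} := by
    intro x hx y hy a b ha hb hab
    have : a • (-x) + b • (-y) ∈ PF n f :=
      (convex_convexHull ℝ (intVec '' (PV n f : Set (Fin 2 → ℤ)))) hx hy ha hb hab
    change -(a • x + b • y) ∈ PF n f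
    convert this using 1
    rw [smul_neg, smul_neg]; abel
  intro z hz
  refine convexHull_min ?_ hc hz
  rintro _ ⟨v, hv, rfl⟩
  simp only [PV, Finset.coe_union, Finset.coe_image, Set.mem_union, Set.mem_image] at hv
  change -intVec v ∈ PF n f
  rcases hv with ⟨x, hx, rfl⟩ | ⟨x, hx, rfl⟩
  · have hx : -(n : ℤ) ≤ x ∧ x ≤ n := by simpa using hx
    have := PF_bot (f := f) (n := n) (x := -x) (by omega)
    convert this using 1
    ext i; fin_cases i <;> simp [intVec]
  · have hx : -(n : ℤ) ≤ x ∧ x ≤ n := by simpa using hx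
    have := PF_top (f := f) (n := n) (x := -x) (by omega)
    convert this using 1
    ext i; fin_cases i <;> simp [intVec]

structure GoodF (n : ℕ) (h : ℤ) (e f : ℤ → ℤ) : Prop where
  hh : 3 * (n : ℤ) ^ 2 + 1 ≤ h
  he : ∀ x, 0 ≤ e x ∧ e x ≤ 2
  hf : ∀ x, f x = h - 3 * x ^ 2 + e x

lemma GoodF.pos {n : ℕ} {h : ℤ} {e f : ℤ → ℤ} (g : GoodF n h e f) {x : ℤ}
    (hx : -(n : ℤ) ≤ x ∧ x ≤ n) : 1 ≤ f x := by
  have h1 := g.hh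
  have h2 := g.he x
  rw [g.hf x]
  nlinarith

lemma PF_lat {n : ℕ} {h : ℤ} {e f : ℤ → ℤ} (g : GoodF n h e f) (v : Fin 2 → ℤ) :
    v ∈ latticePts 2 (PF n f) ↔ (-(n : ℤ) ≤ v 0 ∧ v 0 ≤ n) ∧ -f (-(v 0)) ≤ v 1 ∧ v 1 ≤ f (v 0) := by
  have key : ∀ z ∈ PF n f, ∀ x0 : ℤ, z 1 + 6 * x0 * z 0 ≤ f x0 + 6 * x0 ^ 2 := by
    intro z hz x0
    have hV : ∀ x : ℤ, f x + 6 * x0 * x ≤ f x0 + 6 * x0 ^ 2 := by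
      intro x
      rw [g.hf, g.hf]
      have h1 := g.he x
      have h2 := g.he x0
      rcases eq_or_ne x x0 with rfl | hne
      · nlinarith
      · have : 1 ≤ (x - x0) ^ 2 := by
          have : 0 < (x - x0) ^ 2 := by
            have := sub_ne_zero.2 hne
            positivity
          omega
        nlinarith
    have := hull_le (6 * x0) 1 (f x0 + 6 * x0 ^ 2) (by
      rintro _ ⟨u, hu, rfl⟩
      simp only [PV, Finset.coe_union, Finset.coe_image, Set.mem_union, Set.mem_image] at hu
      rcases hu with ⟨x, hx, rfl⟩ | ⟨x, hx, rfl⟩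
      · have := hV x
        simp only [intVec, Matrix.cons_val_zero, Matrix.cons_val_one]
        have : (f x : ℝ) + 6 * x0 * x ≤ f x0 + 6 * x0 ^ 2 := by exact_mod_cast this
        linarith
      · have hx : -(n : ℤ) ≤ x ∧ x ≤ n := by simpa using hx
        have h1 := hV x
        have h2 := g.pos hx
        have h3 := g.pos (x := -x) (by omega)
        simp only [intVec, Matrix.cons_val_zero, Matrix.cons_val_one]
        have : (-f (-x) : ℝ) + 6 * x0 * x ≤ f x0 + 6 * x0 ^ 2 := by
          have : -f (-x) + 6 * x0 * x ≤ f x0 + 6 * x0 ^ 2 := by linarith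
          exact_mod_cast this
        push_cast
        linarith) z hz
    linarith
  have keyx : ∀ z ∈ PF n f, z 0 ≤ n := by
    intro z hz
    have := hull_le 1 0 n (by
      rintro _ ⟨u, hu, rfl⟩
      simp only [PV, Finset.coe_union, Finset.coe_image, Set.mem_union, Set.mem_image] at hu
      rcases hu with ⟨x, hx, rfl⟩ | ⟨x, hx, rfl⟩ <;>
      · have hx : -(n : ℤ) ≤ x ∧ x ≤ n := by simpa using hx
        simp [intVec]
        exact_mod_cast hx.2) z hz
    linarith
  constructor
  · intro hv
    have hv : intVec v ∈ PF n f := hv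
    have hv' := PF_sym n f _ hv
    have a1 := keyx _ hv
    have a2 := keyx _ hv'
    have a3 := key _ hv (v 0)
    have a4 := key _ hv' (-(v 0))
    simp only [intVec, Pi.neg_apply] at a1 a2 a3 a4
    have a1 : v 0 ≤ n := by exact_mod_cast a1
    have a2 : -(v 0) ≤ n := by exact_mod_cast a2
    have a3 : v 1 + 6 * v 0 * v 0 ≤ f (v 0) + 6 * v 0 ^ 2 := by exact_mod_cast a3
    have a4 : -v 1 + 6 * -(v 0) * -(v 0) ≤ f (-(v 0)) + 6 * (-(v 0)) ^ 2 := by exact_mod_cast a4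
    refine ⟨⟨by omega, a1⟩, by nlinarith, by nlinarith⟩
  · rintro ⟨hx, hl, hu⟩
    change intVec v ∈ PF n f
    have p1 := g.pos hx
    have p2 := g.pos (x := -(v 0)) (by omega)
    have p1' : (1 : ℝ) ≤ f (v 0) := by exact_mod_cast p1
    have p2' : (1 : ℝ) ≤ f (-(v 0)) := by exact_mod_cast p2
    have hl' : -(f (-(v 0)) : ℝ) ≤ v 1 := by exact_mod_cast hl
    have hu' : (v 1 : ℝ) ≤ f (v 0) := by exact_mod_cast hu
    have hs : (0 : ℝ) < f (v 0) + f (-(v 0)) := by linarith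
    have hcv : Convex ℝ (PF n f) := convex_convexHull ℝ _
    have := hcv (PF_top (f := f) hx)
      (PF_bot (f := f) hx) (a := ((v 1 : ℝ) + f (-(v 0))) / (f (v 0) + f (-(v 0))))
      (b := ((f (v 0) : ℝ) - v 1) / (f (v 0) + f (-(v 0))))
      (div_nonneg (by linarith) hs.le) (div_nonneg (by linarith) hs.le)
      (by field_simp; ring)
    convert this using 1
    ext i
    fin_cases i
    · simp [intVec]; field_simp; ring
    · simp [intVec]; field_simp; ring

lemma PF_ncard {n : ℕ} {h : ℤ} {e f : ℤ → ℤ} (g : GoodF n h e f) :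
    ((latticePts 2 (PF n f)).ncard : ℤ) = ∑ x ∈ Finset.Icc (-(n : ℤ)) n, (f x + f (-x) + 1) := by
  let S : Finset (Σ _ : ℤ, ℤ) := (Finset.Icc (-(n : ℤ)) n).sigma (fun x => Finset.Icc (-f (-x)) (f x))
  let φ : (Σ _ : ℤ, ℤ) → (Fin 2 → ℤ) := fun p => ![p.1, p.2]
  have hφ : Function.Injective φ := by
    rintro ⟨a, b⟩ ⟨c, d⟩ h
    have h0 := congrFun h 0
    have h1 := congrFun h 1
    simp [φ] at h0 h1
    simp [h0, h1]
  have : latticePts 2 (PF n f) = φ '' (S : Set (Σ _ : ℤ, ℤ)) := by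
    ext v
    rw [PF_lat g]
    constructor
    · rintro ⟨h1, h2⟩
      refine ⟨⟨v 0, v 1⟩, by simp [S, h1, h2], ?_⟩
      ext i; fin_cases i <;> rfl
    · rintro ⟨⟨a, b⟩, hp, rfl⟩
      simpa [S, φ] using hp
  rw [this, Set.ncard_image_of_injective _ hφ, Set.ncard_coe_finset]
  simp only [S, Finset.card_sigma]
  push_cast
  refine Finset.sum_congr rfl fun x hx => ?_
  rw [Finset.mem_Icc] at hx
  have p1 := g.pos hx
  have p2 := g.pos (x := -x) (by omega)
  rw [Int.card_Icc]
  omega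

lemma PF_pts {n : ℕ} {h : ℤ} {e f : ℤ → ℤ} (g : GoodF n h e f) (hn : 1 ≤ n) :
    (0 : Fin 2 → ℝ) ∈ PF n f ∧ Pi.single 0 1 ∈ PF n f ∧ Pi.single 1 1 ∈ PF n f := by
  have p0 := g.pos (x := 0) (by omega)
  have p1 := g.pos (x := 1) (by omega)
  have p2 := g.pos (x := -1) (by omega)
  have a0 : intVec ![0, 0] ∈ PF n f := (PF_lat g ![0, 0]).2 (by simp; omega)
  have a1 : intVec ![1, 0] ∈ PF n f := (PF_lat g ![1, 0]).2 (by simp; omega)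
  have a2 : intVec ![0, 1] ∈ PF n f := (PF_lat g ![0, 1]).2 (by simp; omega)
  refine ⟨?_, ?_, ?_⟩
  · convert a0 using 1
    ext i; fin_cases i <;> simp [intVec]
  · convert a1 using 1
    ext i; fin_cases i <;> simp [intVec]
  · convert a2 using 1
    ext i; fin_cases i <;> simp [intVec]

lemma PF_full {n : ℕ} {h : ℤ} {e f : ℤ → ℤ} (g : GoodF n h e f) (hn : 1 ≤ n) :
    IsFullDim 2 (PF n f) := by
  obtain ⟨h0, h1, h2⟩ := PF_pts g hn
  unfold IsFullDim
  have m0 := subset_affineSpan ℝ _ h0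
  have m1 := subset_affineSpan ℝ _ h1
  have m2 := subset_affineSpan ℝ _ h2
  rw [eq_top_iff]
  intro z _
  have s1 := AffineSubspace.smul_vsub_vadd_mem (affineSpan ℝ (PF n f)) (z 0) m1 m0 m0
  have s2 := AffineSubspace.smul_vsub_vadd_mem (affineSpan ℝ (PF n f)) (z 1) m2 m0 s1
  convert s2 using 1
  ext i; fin_cases i <;> simp

lemma PF_inj {n : ℕ} {h : ℤ} {e f e' f' : ℤ → ℤ} (g : GoodF n h e f) (g' : GoodF n h e' f')
    (heq : PF n f = PF n f') (x : ℤ) (hx : -(n : ℤ) ≤ x ∧ x ≤ n) : f x = f' x := by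
  have aux : ∀ {e f e' f' : ℤ → ℤ}, GoodF n h e f → GoodF n h e' f' → PF n f = PF n f' →
      f x ≤ f' x := by
    intro e f e' f' g g' heq
    have p1 := g.pos hx
    have p2 := g.pos (x := -x) (by omega)
    have := (PF_lat g ![x, f x]).2 (by simp; omega)
    rw [heq, PF_lat g'] at this
    simpa using this.2.2
  exact le_antisymm (aux g g' heq) (aux g' g heq.symm)

def bitF {n : ℕ} (ω : Fin n → Bool) (x : ℤ) : ℤ :=
  if hx : 1 ≤ x ∧ x ≤ n then (if ω ⟨(x - 1).toNat, by omega⟩ then 1 else 0)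
  else if hx : 1 ≤ -x ∧ -x ≤ n then (if ω ⟨(-x - 1).toNat, by omega⟩ then 0 else 1)
  else 0

def delF (n : ℕ) (r : ℤ) (x : ℤ) : ℤ := if x < -(n : ℤ) + r then 1 else 0

def fF {n : ℕ} (h r : ℤ) (ω : Fin n → Bool) (x : ℤ) : ℤ :=
  h - 3 * x ^ 2 + (delF n r x + bitF ω x)

lemma bitF_range {n : ℕ} (ω : Fin n → Bool) (x : ℤ) : 0 ≤ bitF ω x ∧ bitF ω x ≤ 1 := by
  unfold bitF; split_ifs <;> simp

lemma delF_range (n : ℕ) (r x : ℤ) : 0 ≤ delF n r x ∧ delF n r x ≤ 1 := by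
  unfold delF; split_ifs <;> simp

lemma bitF_add {n : ℕ} (ω : Fin n → Bool) (x : ℤ) (hx : -(n : ℤ) ≤ x ∧ x ≤ n) :
    bitF ω x + bitF ω (-x) = 1 - if x = 0 then 1 else 0 := by
  rcases lt_trichotomy x 0 with h | h | h
  · have h1 : ¬ (1 ≤ x ∧ x ≤ n) := by omega
    have h2 : (1 ≤ -x ∧ -x ≤ n) := by omega
    simp only [bitF, h1, h2, dite_false]
    rw [if_neg (by omega)]
    split_ifs <;> simp_all
  · subst h; simp [bitF]
  · have h1 : (1 ≤ x ∧ x ≤ n) := by omega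
    have h2 : ¬ (1 ≤ -x ∧ -x ≤ n) := by omega
    have h3 : (1 ≤ - -x ∧ - -x ≤ n) := by omega
    simp only [bitF, h1, h2, h3, dite_false]
    rw [if_neg (by omega)]
    simp only [neg_neg]
    split_ifs <;> simp_all

lemma sum_neg_Icc (n : ℕ) (F : ℤ → ℤ) : ∑ x ∈ Finset.Icc (-(n : ℤ)) n, F (-x) =
    ∑ x ∈ Finset.Icc (-(n : ℤ)) n, F x := by
  refine Finset.sum_nbij' (fun x => -x) (fun x => -x) ?_ ?_ ?_ ?_ ?_
  · intro x hx; rw [Finset.mem_Icc] at *; omega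
  · intro x hx; rw [Finset.mem_Icc] at *; omega
  · simp
  · simp
  · simp

lemma sum_del (n : ℕ) (r : ℤ) (h0 : 0 ≤ r) (h1 : r ≤ 2 * n + 1) :
    ∑ x ∈ Finset.Icc (-(n : ℤ)) n, delF n r x = r := by
  unfold delF
  rw [Finset.sum_ite]
  simp only [Finset.sum_const, smul_zero, add_zero]
  have : (Finset.Icc (-(n : ℤ)) n).filter (fun x => x < -(n : ℤ) + r) =
      Finset.Ico (-(n : ℤ)) (-(n : ℤ) + r) := by
    ext x; simp only [Finset.mem_filter, Finset.mem_Icc, Finset.mem_Ico]; omega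
  rw [this]; simp [h0]

lemma sum_f {n : ℕ} (h r : ℤ) (ω : Fin n → Bool) (h0 : 0 ≤ r) (h1 : r ≤ 2 * n + 1) :
    ∑ x ∈ Finset.Icc (-(n : ℤ)) n, (fF h r ω x + fF h r ω (-x) + 1) =
      (2 * n + 1) * (2 * h + 1) - 6 * (∑ x ∈ Finset.Icc (-(n : ℤ)) n, x ^ 2) + 2 * r + 2 * n := by
  have e : ∀ x ∈ Finset.Icc (-(n : ℤ)) n, (fF h r ω x + fF h r ω (-x) + 1) =
      (2 * h + 2) - 6 * x ^ 2 + delF n r x + delF n r (-x) - if x = 0 then 1 else 0 := by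
    intro x hx
    have := bitF_add ω x (Finset.mem_Icc.1 hx)
    unfold fF
    linear_combination this
  rw [Finset.sum_congr rfl e, Finset.sum_sub_distrib, Finset.sum_add_distrib,
    Finset.sum_add_distrib, Finset.sum_sub_distrib, sum_neg_Icc n (delF n r), sum_del n r h0 h1,
    ← Finset.mul_sum]
  simp
  ring_nf
  have : max (1 + n * 2 : ℤ) 0 = 1 + n * 2 := max_eq_left (by omega)
  rw [this]
  ring

lemma fF_good {n : ℕ} {h r : ℤ} (ω : Fin n → Bool) (hh : 3 * (n : ℤ) ^ 2 + 1 ≤ h) :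
    GoodF n h (fun x => delF n r x + bitF ω x) (fF h r ω) :=
  ⟨hh, fun x => by have := bitF_range ω x; have := delF_range n r x; constructor <;> linarith,
    fun x => rfl⟩

lemma fF_inj {n : ℕ} {h r : ℤ} (ω ω' : Fin n → Bool) (hh : 3 * (n : ℤ) ^ 2 + 1 ≤ h)
    (heq : PF n (fF h r ω) = PF n (fF h r ω')) : ω = ω' := by
  ext i
  obtain ⟨i, hi⟩ := i
  have := PF_inj (fF_good (r := r) ω hh) (fF_good (r := r) ω' hh) heq ((i : ℤ) + 1) (by omega)
  have hx : 1 ≤ (i : ℤ) + 1 ∧ (i : ℤ) + 1 ≤ n := by omega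
  simp only [fF, bitF, hx, and_self, dite_true] at this
  have e : ((i : ℤ) + 1 - 1).toNat = i := by omega
  simp only [e] at this
  cases h1 : ω ⟨i, hi⟩ <;> cases h2 : ω' ⟨i, hi⟩ <;> simp_all

lemma affine_det (σ : (Fin 2 → ℝ) ≃ᵃ[ℝ] (Fin 2 → ℝ)) (z : Fin 2 → ℝ) :
    σ z = σ 0 + z 0 • (σ (Pi.single 0 1) - σ 0) + z 1 • (σ (Pi.single 1 1) - σ 0) := by
  have hd : ∀ x, σ x = σ.linear x + σ 0 := by
    intro x
    have := σ.map_vadd 0 x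
    simpa using this
  have hz : z = z 0 • (Pi.single 0 1 : Fin 2 → ℝ) + z 1 • (Pi.single 1 1 : Fin 2 → ℝ) := by
    ext i; fin_cases i <;> simp
  have hl : σ.linear z = z 0 • σ.linear (Pi.single 0 1) + z 1 • σ.linear (Pi.single 1 1) := by
    conv_lhs => rw [hz]
    rw [map_add, map_smul, map_smul]
  rw [hd z, hd (Pi.single 0 1), hd (Pi.single 1 1), hl]
  simp only [add_sub_cancel_right]
  abel

lemma lower_core (w n : ℕ) (hw : Odd w) (hn : 1 ≤ n) (hnw : 125 * n ^ 3 ≤ w) (hfin : Finite (QC w)) :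
    2 ^ n ≤ Nat.card (QC w) * (8 * w + 1) ^ 6 := by
  classical
  obtain ⟨m, hm⟩ := hw
  set S : ℤ := ∑ x ∈ Finset.Icc (-(n : ℤ)) n, x ^ 2 with hS
  have hS0 : 0 ≤ S := Finset.sum_nonneg fun x _ => by positivity
  have hS1 : S ≤ (2 * n + 1) * n ^ 2 := by
    have : S ≤ ∑ x ∈ Finset.Icc (-(n : ℤ)) n, (n : ℤ) ^ 2 := by
      apply Finset.sum_le_sum
      intro x hx
      rw [Finset.mem_Icc] at hx
      nlinarith
    refine this.trans (le_of_eq ?_)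
    rw [Finset.sum_const, Int.card_Icc, nsmul_eq_mul]
    have : (((n : ℤ) + 1 - -(n : ℤ)).toNat : ℤ) = 2 * n + 1 := by omega
    rw [this]
  set T : ℤ := m - 2 * n + 3 * S with hT
  set h : ℤ := T / (2 * n + 1) with hh
  set r : ℤ := T % (2 * n + 1) with hr
  have hTe : r + (2 * n + 1) * h = T := Int.emod_add_mul_ediv T (2 * n + 1)
  have hr0 : 0 ≤ r := Int.emod_nonneg _ (by omega)
  have hr1 : r < 2 * n + 1 := Int.emod_lt_of_pos _ (by omega)
  have hn' : (1 : ℤ) ≤ n := by exact_mod_cast hn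
  have hnw' : 125 * (n : ℤ) ^ 3 ≤ w := by exact_mod_cast hnw
  have hwm : (w : ℤ) = 2 * m + 1 := by exact_mod_cast hm
  have hn2 : (n : ℤ) ≤ n ^ 2 := by nlinarith
  have hn3 : (n : ℤ) ^ 2 ≤ n ^ 3 := by nlinarith
  have hhl : 3 * (n : ℤ) ^ 2 + 1 ≤ h := by
    rw [hh, Int.le_ediv_iff_mul_le (by omega), hT]
    nlinarith
  have hhu : h + 2 ≤ 4 * w := by
    have h1 : h ≤ T := Int.ediv_le_self _ (by rw [hT]; nlinarith)
    have h2 : S ≤ 3 * n ^ 3 := by nlinarith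
    rw [hT] at h1
    nlinarith
  have hnw2 : (n : ℤ) ≤ 4 * w := by nlinarith
  have good := fun ω : Fin n → Bool => fF_good (r := r) ω hhl
  have hcard : ∀ ω : Fin n → Bool, (latticePts 2 (PF n (fF h r ω))).ncard = w := by
    intro ω
    have := PF_ncard (good ω)
    rw [sum_f h r ω hr0 (by omega), ← hS] at this
    have h2 : ((latticePts 2 (PF n (fF h r ω))).ncard : ℤ) = w := by
      rw [this, hwm]; linear_combination 2 * hTe + 2 * hT
    exact_mod_cast h2
  have hprop : ∀ ω : Fin n → Bool, IsConvexLatticePolytope 2 (PF n (fF h r ω)) ∧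
      IsFullDim 2 (PF n (fF h r ω)) ∧ IsCentrallySymmetric 2 (PF n (fF h r ω)) ∧
      (latticePts 2 (PF n (fF h r ω))).ncard = w := by
    intro ω
    refine ⟨PF_poly _ _, PF_full (good ω) hn, ⟨0, fun x => ?_⟩, hcard ω⟩
    simp only [smul_zero, zero_sub]
    exact ⟨PF_sym _ _ x, fun hx => by simpa using PF_sym _ _ _ hx⟩
  let cls : (Fin n → Bool) → QC w := fun ω => Quot.mk _ ⟨PF n (fF h r ω), hprop ω⟩
  have hcls : ∀ ω ω', cls ω = cls ω' → LatticeEquiv 2 (PF n (fF h r ω)) (PF n (fF h r ω')) := by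
    intro ω ω' he
    have := Quot.eqvGen_exact he
    have heq : Equivalence (fun P₁ P₂ : {P : Set (Fin 2 → ℝ) // IsConvexLatticePolytope 2 P ∧
        IsFullDim 2 P ∧ (IsCentrallySymmetric 2 P ∧ (latticePts 2 P).ncard = w)} =>
        LatticeEquiv 2 P₁.1 P₂.1) :=
      ⟨fun P => LatticeEquiv.refl' _, fun h => h.symm', fun h h' => h.trans' h'⟩
    exact (heq.eqvGen_iff).1 this
  let Bx : Finset (Fin 2 → ℤ) := Fintype.piFinset (fun _ => Finset.Icc (-(4 * w : ℤ)) (4 * w))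
  have hBx : Bx.card = (8 * w + 1) ^ 2 := by
    simp only [Bx, Fintype.card_piFinset, Finset.prod_const, Int.card_Icc, Finset.card_univ,
      Fintype.card_fin]
    congr 1; omega
  have hbox : ∀ (ω : Fin n → Bool) (v : Fin 2 → ℤ), v ∈ latticePts 2 (PF n (fF h r ω)) → v ∈ Bx := by
    intro ω v hv
    rw [PF_lat (good ω)] at hv
    have hle : ∀ x, fF h r ω x ≤ h + 2 := by
      intro x
      have := (good ω).he x
      rw [(good ω).hf x]
      nlinarith [sq_nonneg x]
    have h1 := hle (v 0)
    have h2 := hle (-(v 0))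
    simp only [Bx, Fintype.mem_piFinset, Finset.mem_Icc]
    intro i
    fin_cases i
    · simp; omega
    · simp; omega
  -- choose representatives
  have hrep : ∀ q : QC w, ∃ ω0 : Fin n → Bool, ∀ ω, cls ω = q → cls ω0 = q := by
    intro q
    by_cases hq : ∃ ω, cls ω = q
    · obtain ⟨ω0, h0⟩ := hq; exact ⟨ω0, fun _ _ => h0⟩
    · exact ⟨fun _ => true, fun ω hω => absurd ⟨ω, hω⟩ hq⟩
  choose rep hrep using hrep
  have hdata : ∀ ω : Fin n → Bool, ∃ (σ : (Fin 2 → ℝ) ≃ᵃ[ℝ] (Fin 2 → ℝ)) (d : Bx × Bx × Bx),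
      PF n (fF h r ω) = σ '' PF n (fF h r (rep (cls ω))) ∧ intVec d.1.1 = σ 0 ∧
      intVec d.2.1.1 = σ (Pi.single 0 1) ∧ intVec d.2.2.1 = σ (Pi.single 1 1) := by
    intro ω
    obtain ⟨σ, hσ1, hσ2⟩ := hcls _ _ (hrep (cls ω) ω rfl)
    obtain ⟨p0, p1, p2⟩ := PF_pts (good (rep (cls ω))) hn
    have aux : ∀ v : Fin 2 → ℤ, intVec v ∈ PF n (fF h r (rep (cls ω))) →
        ∃ d : Bx, intVec d.1 = σ (intVec v) := by
      intro v hv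
      have : σ (intVec v) ∈ latticeSet 2 := by rw [← hσ1]; exact ⟨_, ⟨v, rfl⟩, rfl⟩
      obtain ⟨u, hu⟩ := this
      refine ⟨⟨u, hbox ω u ?_⟩, hu⟩
      change intVec u ∈ PF n (fF h r ω)
      rw [hu, hσ2]
      exact ⟨_, hv, rfl⟩
    have e0 : intVec (0 : Fin 2 → ℤ) = 0 := by ext i; simp [intVec]
    have e1 : ∀ j : Fin 2, intVec (Pi.single j 1 : Fin 2 → ℤ) = Pi.single j 1 := by
      intro j; ext i; fin_cases i <;> fin_cases j <;> simp [intVec]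
    obtain ⟨d0, h0⟩ := aux 0 (by rw [e0]; exact p0)
    obtain ⟨d1, h1⟩ := aux (Pi.single 0 1) (by rw [e1]; exact p1)
    obtain ⟨d2, h2⟩ := aux (Pi.single 1 1) (by rw [e1]; exact p2)
    rw [e0] at h0
    rw [e1] at h1 h2
    exact ⟨σ, (d0, d1, d2), hσ2, h0, h1, h2⟩
  choose σ d hd0 hd1 hd2 hd3 using hdata
  have hinj : Function.Injective (fun ω => (cls ω, d ω)) := by
    intro ω ω' he
    simp only [Prod.mk.injEq] at he
    obtain ⟨hc, hd⟩ := he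
    apply fF_inj (r := r) ω ω' hhl
    have hσ : ∀ z, σ ω z = σ ω' z := by
      intro z
      rw [affine_det (σ ω), affine_det (σ ω'), ← hd1, ← hd2, ← hd3, ← hd1, ← hd2, ← hd3, hd]
    rw [hd0 ω, hd0 ω', hc]
    exact Set.image_congr fun z _ => hσ z
  have := Nat.card_le_card_of_injective _ hinj
  rw [Nat.card_prod, Nat.card_prod, Nat.card_prod] at this
  simp only [Nat.card_eq_fintype_card, Fintype.card_coe, hBx] at this
  simp only [Fintype.card_pi, Fintype.card_bool, Finset.prod_const, Finset.card_univ,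
    Fintype.card_fin] at this
  refine this.trans (le_of_eq ?_)
  ring

lemma asym : ∃ W : ℕ, ∀ w : ℕ, W ≤ w → 1 ≤ w ∧ 5 ≤ (w : ℝ) ^ ((1 : ℝ) / 3) ∧
    (9 * (w : ℝ)) ^ 6 * Real.exp ((1 / 20) * (w : ℝ) ^ ((1 : ℝ) / 3)) ≤
      Real.exp ((1 / 10) * (w : ℝ) ^ ((1 : ℝ) / 3) - 1 / 2) := by
  have ht : Filter.Tendsto (fun w : ℕ => (w : ℝ) ^ ((1 : ℝ) / 3)) Filter.atTop Filter.atTop :=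
    (tendsto_rpow_atTop (by norm_num)).comp tendsto_natCast_atTop_atTop
  have ho := (isLittleO_pow_exp_pos_mul_atTop 18 (by norm_num : (0 : ℝ) < 1 / 20)).bound
    (by positivity : (0 : ℝ) < Real.exp (-(1 / 2)) / 9 ^ 6)
  have h5 := Filter.eventually_ge_atTop (5 : ℝ)
  have := (ht.eventually ho).and (ht.eventually h5)
  obtain ⟨W, hW⟩ := Filter.eventually_atTop.1 this
  refine ⟨max W 1, fun w hw => ?_⟩
  obtain ⟨h1, h2⟩ := hW w (le_trans (le_max_left _ _) hw)
  refine ⟨le_trans (le_max_right _ _) hw, h2, ?_⟩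
  set L := (w : ℝ) ^ ((1 : ℝ) / 3) with hL
  have hL3 : (w : ℝ) = L ^ 3 := by
    rw [hL, ← Real.rpow_natCast, ← Real.rpow_mul (by positivity)]; norm_num
  rw [Real.norm_of_nonneg (by positivity), Real.norm_of_nonneg (Real.exp_pos _).le] at h1
  have e : Real.exp ((1 / 10) * L - 1 / 2) =
      Real.exp (-(1 / 2)) * Real.exp (1 / 20 * L) * Real.exp (1 / 20 * L) := by
    rw [← Real.exp_add, ← Real.exp_add]; congr 1; ring
  rw [e, hL3]
  apply mul_le_mul_of_nonneg_right _ (Real.exp_pos _).le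
  calc (9 * L ^ 3) ^ 6 = 9 ^ 6 * L ^ 18 := by ring
    _ ≤ 9 ^ 6 * (Real.exp (-(1 / 2)) / 9 ^ 6 * Real.exp (1 / 20 * L)) := by gcongr
    _ = _ := by ring

lemma lower (w : ℕ) (hw : Odd w) (hfin : Finite (QC w)) (h1 : 1 ≤ w)
    (h5 : 5 ≤ (w : ℝ) ^ ((1 : ℝ) / 3))
    (hA : (9 * (w : ℝ)) ^ 6 * Real.exp ((1 / 20) * (w : ℝ) ^ ((1 : ℝ) / 3)) ≤
      Real.exp ((1 / 10) * (w : ℝ) ^ ((1 : ℝ) / 3) - 1 / 2)) :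
    Real.exp ((1 / 20) * (w : ℝ) ^ ((1 : ℝ) / 3)) ≤ (Nat.card (QC w) : ℝ) := by
  set L := (w : ℝ) ^ ((1 : ℝ) / 3) with hL
  have hL3 : (w : ℝ) = L ^ 3 := by
    rw [hL, ← Real.rpow_natCast, ← Real.rpow_mul (by positivity)]; norm_num
  have hwR : (1 : ℝ) ≤ w := by exact_mod_cast h1
  set n := ⌊L / 5⌋₊ with hn
  have hn1 : 1 ≤ n := Nat.le_floor (by push_cast; linarith)
  have hnL : (n : ℝ) ≤ L / 5 := Nat.floor_le (by linarith)
  have hnU : L / 5 < n + 1 := Nat.lt_floor_add_one _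
  have hnw : 125 * n ^ 3 ≤ w := by
    have : 125 * (n : ℝ) ^ 3 ≤ w := by
      rw [hL3]
      calc 125 * (n : ℝ) ^ 3 ≤ 125 * (L / 5) ^ 3 := by gcongr
        _ = L ^ 3 := by ring
    exact_mod_cast this
  have hc := lower_core w n hw hn1 hnw hfin
  have hc' : (2 : ℝ) ^ n ≤ Nat.card (QC w) * (8 * w + 1) ^ 6 := by exact_mod_cast hc
  have h2 : Real.exp (1 / 10 * L - 1 / 2) ≤ 2 ^ n := by
    have : Real.exp (1 / 2) ≤ 2 := by
      rw [← Real.le_log_iff_exp_le (by norm_num)]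
      linarith [Real.log_two_gt_d9]
    calc Real.exp (1 / 10 * L - 1 / 2) ≤ Real.exp (n * (1 / 2)) := by
          apply Real.exp_le_exp.2; linarith
      _ = Real.exp (1 / 2) ^ n := by rw [Real.exp_nat_mul]
      _ ≤ 2 ^ n := by gcongr
  have h3 : (Nat.card (QC w) : ℝ) * (8 * w + 1) ^ 6 ≤ Nat.card (QC w) * (9 * w) ^ 6 := by
    gcongr; linarith
  have h4 : Real.exp (1 / 20 * L) * (9 * (w : ℝ)) ^ 6 ≤ Nat.card (QC w) * (9 * w) ^ 6 := by
    linarith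
  exact le_of_mul_le_mul_right h4 (by positivity)

/-- **Theorem 3.** For all sufficiently large odd `w`, the number `κ*(2,w)` of
equivalence classes of centrally symmetric convex lattice polygons with exactly
`w` lattice points is finite and satisfies
`exp(c₁ w^{1/3}) ≤ κ*(2,w) ≤ exp(c₂ w^{1/3})`. -/
theorem kappastar_two_bounds :
    ∃ c₁ c₂ : ℝ, 0 < c₁ ∧ 0 < c₂ ∧ ∃ W : ℕ, ∀ w : ℕ, W ≤ w → Odd w →
      Finite (ClassesType 2 (fun P => IsCentrallySymmetric 2 P ∧
        (latticePts 2 P).ncard = w)) ∧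
      Real.exp (c₁ * (w : ℝ) ^ ((1 : ℝ) / 3)) ≤
        (Nat.card (ClassesType 2 (fun P => IsCentrallySymmetric 2 P ∧
          (latticePts 2 P).ncard = w)) : ℝ) ∧
      (Nat.card (ClassesType 2 (fun P => IsCentrallySymmetric 2 P ∧
          (latticePts 2 P).ncard = w)) : ℝ) ≤
        Real.exp (c₂ * (w : ℝ) ^ ((1 : ℝ) / 3)) := by
  obtain ⟨W, hW⟩ := asym
  refine ⟨1 / 20, 8 * (2 + zc) + 45, by norm_num, by linarith [zc_nonneg], W, fun w hw ho => ?_⟩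
  obtain ⟨hfin, hu⟩ := upper w ho
  obtain ⟨h1, h2, h3⟩ := hW w hw
  exact ⟨hfin, lower w ho hfin h1 h2 h3, hu⟩

end
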